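/- Let v be a vertex of degree 3 in a smallest counterexample that is not contained in any 5-cycle. Then the weight of v is at most three, and if the weight of v equals three, then v is a (1,1,1)-vertex. -/

import Mathlib

open SimpleGraph

/-- The degree of a vertex, as the cardinality of its neighbor set. -/
noncomputable def deg {V : Type} (G : SimpleGraph V) (v : V) : ℕ :=
  (G.neighborSet v).ncard

/-- The potential of a finite graph: `5 n(G) - 4 e(G)`. -/
noncomputable def pot {V : Type} [Fintype V] (G : SimpleGraph V) : ℤ :=
  5 * (Fintype.card V : ℤ) - 4 * (G.edgeSet.ncard : ℤ)

/-- A graph is 5/2-critical if it has no homomorphism to the 5-cycle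
but every proper subgraph has one. -/
def Critical52 {V : Type} (G : SimpleGraph V) : Prop :=
  IsEmpty (G →g cycleGraph 5) ∧
  ∀ H : G.Subgraph, H ≠ ⊤ → Nonempty (H.coe →g cycleGraph 5)

/-- The exceptional graph `E₁`: a 9-cycle `0 1 2 3 4 5 6 7 8` together
with a vertex `9` adjacent to `0`, `3` and `6`. -/
def E1 : SimpleGraph (Fin 10) := SimpleGraph.fromEdgeSet
  {s(0,1), s(1,2), s(2,3), s(3,4), s(4,5), s(5,6), s(6,7), s(7,8), s(8,0),
   s(9,0), s(9,3), s(9,6)}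

/-- The exceptional graph `E₂`: two 5-cycles `0 1 2 3 4` and `0 1 5 6 7`
sharing exactly the edge `01`, together with a path `3 8 9 6`. -/
def E2 : SimpleGraph (Fin 10) := SimpleGraph.fromEdgeSet
  {s(0,1), s(1,2), s(2,3), s(3,4), s(4,0),
   s(1,5), s(5,6), s(6,7), s(7,0),
   s(3,8), s(8,9), s(9,6)}

/-- A smallest counterexample: a 5/2-critical graph, not isomorphic to `C₃`, `E₁`, `E₂`,
with potential at least 2, such that every smaller 5/2-critical graph not isomorphic
to `C₃`, `E₁`, `E₂` has potential at most 1. -/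
def SmallestCex {V : Type} [Fintype V] (G : SimpleGraph V) : Prop :=
  Critical52 G ∧ IsEmpty (G ≃g cycleGraph 3) ∧ IsEmpty (G ≃g E1) ∧ IsEmpty (G ≃g E2) ∧
  2 ≤ pot G ∧
  ∀ (m : ℕ) (H : SimpleGraph (Fin m)), Critical52 H →
    IsEmpty (H ≃g cycleGraph 3) → IsEmpty (H ≃g E1) → IsEmpty (H ≃g E2) →
    m < Fintype.card V → pot H ≤ 1

/-- A string: a path of positive length whose endvertices have degree at least 3
and whose internal vertices have degree 2. A `k`-string is a string of length `k+1`. -/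
def IsString {V : Type} (G : SimpleGraph V) {u v : V} (p : G.Walk u v) : Prop :=
  p.IsPath ∧ 0 < p.length ∧ 3 ≤ deg G u ∧ 3 ≤ deg G v ∧
  ∀ w ∈ p.support, w ≠ u → w ≠ v → deg G w = 2

/-- `v` lies on a 5-cycle of `G`. -/
def InFiveCycle {V : Type} (G : SimpleGraph V) (v : V) : Prop :=
  ∃ (w : V) (c : G.Walk w w), c.IsCycle ∧ c.length = 5 ∧ v ∈ c.support

/-- `v` is a `(k₁,k₂,k₃)`-vertex: it has degree 3 and is the end of a `k₁`-string,
a `k₂`-string and a `k₃`-string leaving `v` through its three distinct edges. -/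
def IsVertex3 {V : Type} (G : SimpleGraph V) (v : V) (k1 k2 k3 : ℕ) : Prop :=
  deg G v = 3 ∧ ∃ (u1 u2 u3 : V) (p1 : G.Walk v u1) (p2 : G.Walk v u2) (p3 : G.Walk v u3),
    IsString G p1 ∧ IsString G p2 ∧ IsString G p3 ∧
    p1.getVert 1 ≠ p2.getVert 1 ∧ p1.getVert 1 ≠ p3.getVert 1 ∧ p2.getVert 1 ≠ p3.getVert 1 ∧
    p1.length = k1 + 1 ∧ p2.length = k2 + 1 ∧ p3.length = k3 + 1

/-- `v` is a `(k₁,k₂,k₃,k₄)`-vertex: it has degree 4 and is the end of strings of the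
corresponding lengths leaving `v` through its four distinct edges. -/
def IsVertex4 {V : Type} (G : SimpleGraph V) (v : V) (k1 k2 k3 k4 : ℕ) : Prop :=
  deg G v = 4 ∧ ∃ (u1 u2 u3 u4 : V) (p1 : G.Walk v u1) (p2 : G.Walk v u2)
    (p3 : G.Walk v u3) (p4 : G.Walk v u4),
    IsString G p1 ∧ IsString G p2 ∧ IsString G p3 ∧ IsString G p4 ∧
    p1.getVert 1 ≠ p2.getVert 1 ∧ p1.getVert 1 ≠ p3.getVert 1 ∧ p1.getVert 1 ≠ p4.getVert 1 ∧
    p2.getVert 1 ≠ p3.getVert 1 ∧ p2.getVert 1 ≠ p4.getVert 1 ∧ p3.getVert 1 ≠ p4.getVert 1 ∧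
    p1.length = k1 + 1 ∧ p2.length = k2 + 1 ∧ p3.length = k3 + 1 ∧ p4.length = k4 + 1

/-- `H` contains at least two distinct cycles, where cycles are counted as subgraphs,
i.e. two cycles are distinct if their edge sets differ. -/
def TwoDistinctCycles {V : Type} (H : SimpleGraph V) : Prop :=
  ∃ (v1 v2 : V) (c1 : H.Walk v1 v1) (c2 : H.Walk v2 v2),
    c1.IsCycle ∧ c2.IsCycle ∧ {e | e ∈ c1.edges} ≠ {e | e ∈ c2.edges}

/-- The degree of a 5-cycle (cell) `c` in `G`: the number of strings not contained in `c`
that intersect `c`, strings being counted by their edge sets. -/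
noncomputable def cellDegree {V : Type} (G : SimpleGraph V) {w : V} (c : G.Walk w w) : ℕ :=
  {S : Set (Sym2 V) | ∃ (u v : V) (p : G.Walk u v), IsString G p ∧ S = {e | e ∈ p.edges} ∧
    ¬ S ⊆ {e | e ∈ c.edges} ∧ ∃ x ∈ p.support, x ∈ c.support}.ncard


/-! ## Colourings of edge sets -/

namespace FH

/-- Adjacency in the 5-cycle. -/
def A5 (a b : Fin 5) : Prop := a - b = 1 ∨ b - a = 1

instance (a b : Fin 5) : Decidable (A5 a b) := by unfold A5; infer_instance

/-- Being joined by a walk of length two in the 5-cycle. -/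
def two (a b : Fin 5) : Prop := ¬ A5 a b

instance (a b : Fin 5) : Decidable (two a b) := by unfold two; infer_instance

lemma A5.symm {a b : Fin 5} (h : A5 a b) : A5 b a := Or.symm h

lemma A5.ne {a b : Fin 5} (h : A5 a b) : a ≠ b := by
  revert a b; decide

lemma two_mid : ∀ a b : Fin 5, two a b → ∃ c, A5 c a ∧ A5 c b := by decide

lemma ne_mid : ∀ a b : Fin 5, a ≠ b → ∃ c d, A5 c a ∧ A5 c d ∧ A5 d b := by decide

/-- `f` colours the edge set `E`. -/
def Clr {V : Type} (f : V → Fin 5) (E : Finset (Sym2 V)) : Prop :=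
  ∀ a b, s(a, b) ∈ E → A5 (f a) (f b)

def Col {V : Type} (E : Finset (Sym2 V)) : Prop := ∃ f : V → Fin 5, Clr f E

/-- `f` colours all edges of `E` that avoid `I`. -/
def ClrOff {V : Type} (f : V → Fin 5) (E : Finset (Sym2 V)) (I : Finset V) : Prop :=
  ∀ a b, s(a, b) ∈ E → a ∉ I → b ∉ I → A5 (f a) (f b)

lemma Col.mono {V : Type} {E F : Finset (Sym2 V)} (h : E ⊆ F) (hF : Col F) : Col E := by
  obtain ⟨f, hf⟩ := hF
  exact ⟨f, fun a b hab => hf a b (h hab)⟩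

def ND {V : Type} (E : Finset (Sym2 V)) : Prop := ∀ a, s(a, a) ∉ E

/-- Minimal uncolourable edge sets. -/
def MinU {V : Type} (E : Finset (Sym2 V)) : Prop := ¬ Col E ∧ ∀ E', E' ⊂ E → Col E'

lemma exists_minU {V : Type} (F : Finset (Sym2 V)) (hF : ¬ Col F) :
    ∃ K, K ⊆ F ∧ MinU K := by
  classical
  induction F using Finset.strongInduction with
  | H F ih =>
    by_cases hmin : ∀ E', E' ⊂ F → Col E'
    · exact ⟨F, Finset.Subset.refl _, hF, hmin⟩
    · push Not at hmin
      obtain ⟨E', hE', hc⟩ := hmin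
      obtain ⟨K, hK, hm⟩ := ih E' hE' hc
      exact ⟨K, hK.trans hE'.1, hm⟩

variable {V : Type} [Fintype V] [DecidableEq V]

/-- The set of endpoints of an edge set. -/
def spt (E : Finset (Sym2 V)) : Finset V := Finset.univ.filter (fun v => ∃ u, s(v, u) ∈ E)

lemma mem_spt {E : Finset (Sym2 V)} {v : V} : v ∈ spt E ↔ ∃ u, s(v, u) ∈ E := by
  simp [spt]

lemma mem_spt_left {E : Finset (Sym2 V)} {v u : V} (h : s(v, u) ∈ E) : v ∈ spt E :=
  mem_spt.2 ⟨u, h⟩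

lemma mem_spt_right {E : Finset (Sym2 V)} {v u : V} (h : s(v, u) ∈ E) : u ∈ spt E :=
  mem_spt.2 ⟨v, by rwa [Sym2.eq_swap]⟩

/-- `E` is a copy of `Q`. -/
def Copy {k : ℕ} (Q : Finset (Sym2 (Fin k))) (E : Finset (Sym2 V)) : Prop :=
  ∃ ι : Fin k → V, Function.Injective ι ∧ E = Q.image (Sym2.map ι)

def T3 : Finset (Sym2 (Fin 3)) := {s(0, 1), s(1, 2), s(0, 2)}

def Q1 : Finset (Sym2 (Fin 10)) :=
  {s(0,1), s(1,2), s(2,3), s(3,4), s(4,5), s(5,6), s(6,7), s(7,8), s(8,0),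
   s(9,0), s(9,3), s(9,6)}

def Q2 : Finset (Sym2 (Fin 10)) :=
  {s(0,1), s(1,2), s(2,3), s(3,4), s(4,0),
   s(1,5), s(5,6), s(6,7), s(7,0),
   s(3,8), s(8,9), s(9,6)}

lemma mem_copy {k : ℕ} {Q : Finset (Sym2 (Fin k))} {ι : Fin k → V} (hι : Function.Injective ι)
    (i j : Fin k) : s(ι i, ι j) ∈ Q.image (Sym2.map ι) ↔ s(i, j) ∈ Q := by
  constructor
  · intro h
    obtain ⟨e, he, heq⟩ := Finset.mem_image.1 h
    have : e = s(i, j) := Sym2.map.injective hι (by rw [heq, Sym2.map_mk])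
    rwa [← this]
  · intro h
    exact Finset.mem_image.2 ⟨_, h, by rw [Sym2.map_mk]⟩

lemma copy_exists {k : ℕ} {Q : Finset (Sym2 (Fin k))} {ι : Fin k → V}
    {a b : V} (h : s(a, b) ∈ Q.image (Sym2.map ι)) :
    ∃ i j, ι i = a ∧ ι j = b ∧ s(i, j) ∈ Q := by
  obtain ⟨e, he, heq⟩ := Finset.mem_image.1 h
  induction e with
  | _ i j =>
    rw [Sym2.map_mk, Sym2.eq_iff] at heq
    rcases heq with ⟨h1, h2⟩ | ⟨h1, h2⟩
    · exact ⟨i, j, h1, h2, he⟩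
    · exact ⟨j, i, h2, h1, by rwa [Sym2.eq_swap]⟩

lemma copy_card {k : ℕ} {Q : Finset (Sym2 (Fin k))} {ι : Fin k → V} (hι : Function.Injective ι) :
    (Q.image (Sym2.map ι)).card = Q.card :=
  Finset.card_image_of_injective _ (Sym2.map.injective hι)

lemma copy_spt {k : ℕ} {Q : Finset (Sym2 (Fin k))} {ι : Fin k → V} (hι : Function.Injective ι)
    (hQ : ∀ i, ∃ j, s(i, j) ∈ Q) :
    spt (Q.image (Sym2.map ι)) = Finset.univ.image ι := by
  ext v
  rw [mem_spt, Finset.mem_image]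
  constructor
  · rintro ⟨u, hu⟩
    obtain ⟨i, j, h1, h2, h3⟩ := copy_exists hu
    exact ⟨i, Finset.mem_univ _, h1⟩
  · rintro ⟨i, -, rfl⟩
    obtain ⟨j, hj⟩ := hQ i
    exact ⟨ι j, (mem_copy hι i j).2 hj⟩

lemma copy_spt_card {k : ℕ} {Q : Finset (Sym2 (Fin k))} {ι : Fin k → V}
    (hι : Function.Injective ι) (hQ : ∀ i, ∃ j, s(i, j) ∈ Q) :
    (spt (Q.image (Sym2.map ι))).card = k := by
  rw [copy_spt hι hQ, Finset.card_image_of_injective _ hι]; simp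

lemma T3_cov : ∀ i, ∃ j, s(i, j) ∈ T3 := by decide
lemma Q1_cov : ∀ i, ∃ j, s(i, j) ∈ Q1 := by decide
lemma Q2_cov : ∀ i, ∃ j, s(i, j) ∈ Q2 := by decide
lemma T3_card : T3.card = 3 := by decide
lemma Q1_card : Q1.card = 12 := by decide
lemma Q2_card : Q2.card = 12 := by decide
lemma T3_complete : ∀ i j, i ≠ j → s(i, j) ∈ T3 := by decide

lemma T3_copy_complete {E : Finset (Sym2 V)} (h : Copy T3 E) {a b : V} (ha : a ∈ spt E)
    (hb : b ∈ spt E) (hab : a ≠ b) : s(a, b) ∈ E := by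
  obtain ⟨ι, hι, rfl⟩ := h
  rw [copy_spt hι T3_cov, Finset.mem_image] at ha hb
  obtain ⟨i, -, rfl⟩ := ha
  obtain ⟨j, -, rfl⟩ := hb
  exact (mem_copy hι i j).2 (T3_complete i j (fun h => hab (h ▸ rfl)))

/-- What is used about a smallest counterexample, in terms of its edge set. -/
structure Ctx (E : Finset (Sym2 V)) : Prop where
  nd : ND E
  ncol : ¬ Col E
  crit : ∀ E', E' ⊂ E → Col E'
  cov : ∀ v, ∃ u, s(v, u) ∈ E
  pot : 4 * E.card + 2 ≤ 5 * Fintype.card V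
  notri : ∀ a b c, s(a, b) ∈ E → s(b, c) ∈ E → s(a, c) ∈ E → False
  min : ∀ K : Finset (Sym2 V), ND K → MinU K → (spt K).card < Fintype.card V →
    5 * (spt K).card ≤ 4 * K.card + 1 ∨ Copy T3 K ∨ Copy Q1 K ∨ Copy Q2 K

/-- Edges of `E` inside `S`. -/
def ins (E : Finset (Sym2 V)) (S : Finset V) : Finset (Sym2 V) :=
  E.filter (fun e => ∀ v ∈ e, v ∈ S)

lemma mem_ins {E : Finset (Sym2 V)} {S : Finset V} {a b : V} :
    s(a, b) ∈ ins E S ↔ s(a, b) ∈ E ∧ a ∈ S ∧ b ∈ S := by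
  simp [ins]

def C5E : Finset (Sym2 (Fin 5)) := {s(0,1), s(1,2), s(2,3), s(3,4), s(4,0)}

lemma C5E_mem : ∀ a b, A5 a b → s(a, b) ∈ C5E := by decide

lemma C5_pot : ∀ X : Finset (Fin 5), X.Nonempty →
    4 * (ins C5E X).card + 5 ≤ 5 * X.card ∧
    (4 * (ins C5E X).card + 5 = 5 * X.card → X.card = 1 ∨ X.card = 5) := by
  unfold ins
  decide +kernel

/-- Edges coloured injectively. -/
lemma inj_pot (X : Finset V) (hX : X.Nonempty) (E : Finset (Sym2 V)) (φ : V → Fin 5)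
    (hE : ∀ a b, s(a, b) ∈ E → a ∈ X ∧ b ∈ X ∧ A5 (φ a) (φ b)) (hinj : Set.InjOn φ X) :
    4 * E.card + 5 ≤ 5 * X.card ∧ (4 * E.card + 5 = 5 * X.card → X.card = 1 ∨ X.card = 5) := by
  have h1 : (X.image φ).card = X.card := Finset.card_image_of_injOn hinj
  have h2 : E.card ≤ (ins C5E (X.image φ)).card := by
    refine Finset.card_le_card_of_injOn (Sym2.map φ) ?_ ?_
    · intro e he
      induction e with
      | _ a b =>
        obtain ⟨ha, hb, hab⟩ := hE a b he
        rw [Sym2.map_mk]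
        exact mem_ins.2 ⟨C5E_mem _ _ hab, Finset.mem_image_of_mem _ ha,
          Finset.mem_image_of_mem _ hb⟩
    · intro e he e' he' heq
      induction e with
      | _ a b =>
      induction e' with
      | _ c d =>
        obtain ⟨ha, hb, hab⟩ := hE a b he
        obtain ⟨hc, hd, hcd⟩ := hE c d he'
        rw [Sym2.map_mk, Sym2.map_mk, Sym2.eq_iff] at heq
        rw [Sym2.eq_iff]
        rcases heq with ⟨p, q⟩ | ⟨p, q⟩
        · exact Or.inl ⟨hinj ha hc p, hinj hb hd q⟩
        · exact Or.inr ⟨hinj ha hd p, hinj hb hc q⟩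
  obtain ⟨h3, h4⟩ := C5_pot (X.image φ) (hX.image φ)
  rw [h1] at h3 h4
  constructor
  · omega
  · intro h; apply h4; omega

/-- The potential lemma. -/
lemma potential {EG : Finset (Sym2 V)} (C : Ctx EG) : ∀ (N : ℕ) (S : Finset V),
    Fintype.card V - S.card = N → S.Nonempty → S ≠ Finset.univ →
    4 * (ins EG S).card + 4 ≤ 5 * S.card ∧
    (4 * (ins EG S).card + 4 = 5 * S.card → S.card + 2 = Fintype.card V) := by
  intro N
  induction N using Nat.strong_induction_on with
  | _ N ih =>
  intro S hN hne hSu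
  obtain ⟨o, ho⟩ : ∃ o, o ∉ S := by
    by_contra hcon
    push Not at hcon
    exact hSu (Finset.eq_univ_iff_forall.2 hcon)
  have hlt : S.card < Fintype.card V := by
    rw [← Finset.card_univ]
    exact Finset.card_lt_card (Finset.ssubset_univ_iff.2 hSu)
  have hss : ins EG S ⊂ EG := by
    refine ⟨Finset.filter_subset _ _, fun hsub => ?_⟩
    obtain ⟨u, hu⟩ := C.cov o
    exact ho (mem_ins.1 (hsub hu)).2.1
  obtain ⟨φ, hφ⟩ := C.crit _ hss
  by_cases hinj : Set.InjOn φ S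
  · have := inj_pot S hne (ins EG S) φ (fun a b hab =>
      ⟨(mem_ins.1 hab).2.1, (mem_ins.1 hab).2.2, hφ a b hab⟩) hinj
    omega
  -- identify colour classes
  have hinj' : ∃ u ∈ S, ∃ u' ∈ S, φ u = φ u' ∧ u ≠ u' := by
    simpa [Set.InjOn] using hinj
  obtain ⟨u0, hu0, u1, hu1, heq01, hne01⟩ := hinj'
  obtain ⟨s0, hs0⟩ := hne
  haveI : Nonempty V := ⟨s0⟩
  let r : Fin 5 → V := Function.invFunOn φ (S : Set V)
  have hr : ∀ u ∈ S, r (φ u) ∈ S ∧ φ (r (φ u)) = φ u := by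
    intro u hu
    have hex : ∃ a ∈ (S : Set V), φ a = φ u := ⟨u, hu, rfl⟩
    exact ⟨Function.invFunOn_mem hex, Function.invFunOn_eq hex⟩
  let q : V → V := fun u => if u ∈ S then r (φ u) else u
  have qS : ∀ u, u ∈ S → q u = r (φ u) := fun u hu => if_pos hu
  have qO : ∀ u, u ∉ S → q u = u := fun u hu => if_neg hu
  have qmem : ∀ u, q u ∈ S ↔ u ∈ S := by
    intro u
    by_cases hu : u ∈ S
    · rw [qS u hu]; exact ⟨fun _ => hu, fun _ => (hr u hu).1⟩
    · rw [qO u hu]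
  let F := EG.image (Sym2.map q)
  have Fex : ∀ a b, s(a, b) ∈ F → ∃ u v, q u = a ∧ q v = b ∧ s(u, v) ∈ EG := by
    intro a b hab
    obtain ⟨e, he, heq⟩ := Finset.mem_image.1 hab
    induction e with
    | _ i j =>
      rw [Sym2.map_mk, Sym2.eq_iff] at heq
      rcases heq with ⟨h1, h2⟩ | ⟨h1, h2⟩
      · exact ⟨i, j, h1, h2, he⟩
      · exact ⟨j, i, h2, h1, by rwa [Sym2.eq_swap]⟩
  have hFnd : ND F := by
    intro a ha
    obtain ⟨u, v, h1, h2, h3⟩ := Fex a a ha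
    by_cases hu : u ∈ S
    · have hv : v ∈ S := by rw [← qmem, h2, ← h1, qmem]; exact hu
      have := (hφ u v (mem_ins.2 ⟨h3, hu, hv⟩)).ne
      rw [qS u hu] at h1
      rw [qS v hv] at h2
      apply this
      rw [← (hr u hu).2, ← (hr v hv).2, h1, h2]
    · have hv : v ∉ S := by rw [← qmem, h2, ← h1, qmem]; exact hu
      rw [qO u hu] at h1
      rw [qO v hv] at h2
      subst h1; subst h2
      exact C.nd _ h3
  have hFnc : ¬ Col F := by
    rintro ⟨f, hf⟩
    apply C.ncol
    refine ⟨f ∘ q, fun a b hab => hf _ _ ?_⟩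
    exact Finset.mem_image.2 ⟨_, hab, by rw [Sym2.map_mk]⟩
  obtain ⟨K, hKF, hK⟩ := exists_minU F hFnc
  have hKnd : ND K := fun a ha => hFnd a (hKF ha)
  have hsptq : spt K ⊆ Finset.univ.image q := by
    intro a ha
    obtain ⟨b, hb⟩ := mem_spt.1 ha
    obtain ⟨u, v, h1, h2, h3⟩ := Fex a b (hKF hb)
    exact Finset.mem_image.2 ⟨u, Finset.mem_univ _, h1⟩
  have hlt2 : (spt K).card < Fintype.card V := by
    refine lt_of_le_of_lt (Finset.card_le_card hsptq) ?_
    rw [← Finset.card_univ]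
    refine lt_of_le_of_ne Finset.card_image_le ?_
    intro hc
    have := Finset.card_image_iff.1 hc
    apply hne01
    apply this (by simp) (by simp)
    rw [qS _ hu0, qS _ hu1, heq01]
  have hmin := C.min K hKnd hK hlt2
  -- splitting
  let A := spt K \ S
  let X := spt K ∩ S
  let K2 := ins K S
  let K1 := K \ K2
  have cAX : A.card + X.card = (spt K).card := Finset.card_sdiff_add_card_inter _ _
  have cK : K1.card + K2.card = K.card := by
    have hsub : K2 ⊆ K := Finset.filter_subset _ _
    have := Finset.card_sdiff_add_card_eq_card hsub
    exact this
  have hφK2 : ∀ a b, s(a, b) ∈ K2 → a ∈ X ∧ b ∈ X ∧ A5 (φ a) (φ b) := by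
    intro a b hab
    obtain ⟨h1, h2, h3⟩ := mem_ins.1 hab
    refine ⟨Finset.mem_inter.2 ⟨mem_spt_left h1, h2⟩, Finset.mem_inter.2 ⟨mem_spt_right h1, h3⟩, ?_⟩
    obtain ⟨u, v, g1, g2, g3⟩ := Fex a b (hKF h1)
    have hu : u ∈ S := by rw [← qmem, g1]; exact h2
    have hv : v ∈ S := by rw [← qmem, g2]; exact h3
    rw [← g1, ← g2, qS u hu, qS v hv, (hr u hu).2, (hr v hv).2]
    exact hφ u v (mem_ins.2 ⟨g3, hu, hv⟩)
  have hXinj : Set.InjOn φ X := by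
    intro a ha b hb hab
    have ha' := Finset.mem_inter.1 ha
    have hb' := Finset.mem_inter.1 hb
    obtain ⟨u, -, hu⟩ := Finset.mem_image.1 (hsptq ha'.1)
    obtain ⟨v, -, hv⟩ := Finset.mem_image.1 (hsptq hb'.1)
    have huS : u ∈ S := by rw [← qmem, hu]; exact ha'.2
    have hvS : v ∈ S := by rw [← qmem, hv]; exact hb'.2
    rw [← hu, ← hv, qS u huS, qS v hvS, (hr u huS).2, (hr v hvS).2] at hab
    rw [← hu, ← hv, qS u huS, qS v hvS, hab]
  have hXne : X.Nonempty := by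
    by_contra hX
    rw [Finset.not_nonempty_iff_eq_empty] at hX
    have hout : ∀ a ∈ spt K, a ∉ S := by
      intro a ha haS
      have : a ∈ X := Finset.mem_inter.2 ⟨ha, haS⟩
      rw [hX] at this
      simp at this
    have hsub : K ⊆ EG := by
      intro e he
      induction e with
      | _ a b =>
        obtain ⟨u, v, g1, g2, g3⟩ := Fex a b (hKF he)
        have hu : u ∉ S := by rw [← qmem, g1]; exact hout a (mem_spt_left he)
        have hv : v ∉ S := by rw [← qmem, g2]; exact hout b (mem_spt_right he)
        rw [qO u hu] at g1
        rw [qO v hv] at g2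
        rw [← g1, ← g2]; exact g3
    apply hK.1
    apply C.crit
    refine ⟨hsub, fun hsub' => ?_⟩
    obtain ⟨u, hu⟩ := C.cov s0
    exact hout s0 (mem_spt_left (hsub' hu)) hs0
  have hAne : A.Nonempty := by
    by_contra hA
    rw [Finset.not_nonempty_iff_eq_empty] at hA
    have hin : ∀ a ∈ spt K, a ∈ S := by
      intro a ha
      by_contra haS
      have : a ∈ A := Finset.mem_sdiff.2 ⟨ha, haS⟩
      rw [hA] at this
      simp at this
    apply hK.1
    refine ⟨φ, fun a b hab => ?_⟩
    exact (hφK2 a b (mem_ins.2 ⟨hab, hin a (mem_spt_left hab), hin b (mem_spt_right hab)⟩)).2.2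
  have hXpot := inj_pot X hXne K2 φ hφK2 hXinj
  -- lifting
  have hlift : ∀ e ∈ K1, ∃ e' ∈ EG, Sym2.map q e' = e := by
    intro e he
    exact Finset.mem_image.1 (hKF (Finset.mem_sdiff.1 he).1)
  let ℓ : Sym2 V → Sym2 V := fun e => if he : e ∈ K1 then (hlift e he).choose else e
  have hℓ : ∀ e ∈ K1, ℓ e ∈ EG ∧ Sym2.map q (ℓ e) = e := by
    intro e he
    simp only [ℓ, dif_pos he]
    exact (hlift e he).choose_spec
  let L := K1.image ℓ
  have hLcard : L.card = K1.card := by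
    apply Finset.card_image_of_injOn
    intro e he e' he' heq
    rw [← (hℓ e he).2, ← (hℓ e' he').2, heq]
  let S' := S ∪ A
  have hLins : L ⊆ ins EG S' \ ins EG S := by
    intro e he
    obtain ⟨e', he', rfl⟩ := Finset.mem_image.1 he
    obtain ⟨h1, h2⟩ := hℓ e' he'
    generalize hx : ℓ e' = x at h1 h2
    induction x with
    | _ a b =>
      rw [Sym2.map_mk] at h2
      rw [← h2] at he'
      obtain ⟨k1, k2⟩ := Finset.mem_sdiff.1 he'
      have key : ∀ c, q c ∈ spt K → c ∈ S' := by
        intro c hc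
        by_cases hcS : c ∈ S
        · exact Finset.mem_union_left _ hcS
        · rw [qO c hcS] at hc
          exact Finset.mem_union_right _ (Finset.mem_sdiff.2 ⟨hc, hcS⟩)
      refine Finset.mem_sdiff.2 ⟨mem_ins.2 ⟨h1, key a (mem_spt_left k1), key b (mem_spt_right k1)⟩, ?_⟩
      intro hin
      obtain ⟨-, ha, hb⟩ := mem_ins.1 hin
      exact k2 (mem_ins.2 ⟨k1, (qmem a).2 ha, (qmem b).2 hb⟩)
  have hsubS : ins EG S ⊆ ins EG S' := by
    intro e he
    induction e with
    | _ a b =>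
      obtain ⟨h1, h2, h3⟩ := mem_ins.1 he
      exact mem_ins.2 ⟨h1, Finset.mem_union_left _ h2, Finset.mem_union_left _ h3⟩
  have cH : (ins EG S).card + K1.card ≤ (ins EG S').card := by
    have h1 := Finset.card_le_card hLins
    have h2 := Finset.card_sdiff_add_card_eq_card hsubS
    omega
  have cS' : S'.card = S.card + A.card :=
    Finset.card_union_of_disjoint Finset.disjoint_sdiff
  have hApos : 0 < A.card := Finset.card_pos.2 hAne
  have hXpos : 0 < X.card := Finset.card_pos.2 hXne
  have hS' : (4 * (ins EG S').card + 2 ≤ 5 * S'.card) ∧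
      (S'.card ≠ Fintype.card V → 4 * (ins EG S').card + 4 ≤ 5 * S'.card) := by
    by_cases hu : S' = Finset.univ
    · have h1 : S'.card = Fintype.card V := by rw [hu, Finset.card_univ]
      have h2 : (ins EG S').card ≤ EG.card := Finset.card_le_card (Finset.filter_subset _ _)
      have h3 := C.pot
      exact ⟨by omega, fun h => absurd h1 h⟩
    · have hle : S'.card ≤ Fintype.card V := Finset.card_le_univ _
      have := (ih (Fintype.card V - S'.card) (by omega) S' rfl
        ⟨s0, Finset.mem_union_left _ hs0⟩ hu).1
      exact ⟨by omega, fun _ => this⟩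
  obtain ⟨hS'1, hS'2⟩ := hS'
  obtain ⟨hX1, hX2⟩ := hXpot
  rcases hmin with h | ⟨ι, hι, hKeq⟩ | ⟨ι, hι, hKeq⟩ | ⟨ι, hι, hKeq⟩
  · constructor <;> omega
  · have e1 := copy_spt_card hι T3_cov
    have e2 := copy_card (Q := T3) hι
    rw [← hKeq] at e1 e2
    rw [T3_card] at e2
    constructor
    · omega
    · intro heq
      by_cases hc : S'.card = Fintype.card V
      · have : X.card = 1 ∨ X.card = 5 := hX2 (by omega)
        omega
      · have := hS'2 hc
        omega
  · have e1 := copy_spt_card hι Q1_cov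
    have e2 := copy_card (Q := Q1) hι
    rw [← hKeq] at e1 e2
    rw [Q1_card] at e2
    constructor <;> omega
  · have e1 := copy_spt_card hι Q2_cov
    have e2 := copy_card (Q := Q2) hι
    rw [← hKeq] at e1 e2
    rw [Q2_card] at e2
    constructor <;> omega

lemma potential' {EG : Finset (Sym2 V)} (C : Ctx EG) (S : Finset V) (E : Finset (Sym2 V))
    (hE : E ⊆ EG) (hES : ∀ a b, s(a, b) ∈ E → a ∈ S ∧ b ∈ S) (hne : S.Nonempty)
    (hS : S ≠ Finset.univ) :
    4 * E.card + 4 ≤ 5 * S.card ∧ (4 * E.card + 4 = 5 * S.card → S.card + 2 = Fintype.card V) := by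
  have h1 : E ⊆ ins EG S := by
    intro e he
    induction e with
    | _ a b => exact mem_ins.2 ⟨hE he, hES a b he⟩
  have h2 := Finset.card_le_card h1
  obtain ⟨h3, h4⟩ := potential C _ S rfl hne hS
  constructor
  · omega
  · intro h; apply h4; omega

/-! ## Finite checks on the exceptional graphs -/

def R1 : List (Fin 10 × Fin 10) :=
  [(0,1), (1,2), (2,3), (3,4), (4,5), (5,6), (6,7), (7,8), (8,0), (9,0), (9,3), (9,6)]

def R2 : List (Fin 10 × Fin 10) :=
  [(0,1), (1,2), (2,3), (3,4), (4,0), (1,5), (5,6), (6,7), (7,0), (3,8), (8,9), (9,6)]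

def LA1 : List (Fin 10 → Fin 5) :=
  [![0, 2, 1, 0, 1, 2, 3, 2, 1, 4],
   ![0, 1, 2, 0, 1, 2, 3, 2, 1, 4],
   ![0, 4, 3, 2, 4, 3, 2, 3, 4, 1],
   ![0, 4, 3, 2, 3, 4, 2, 3, 4, 1],
   ![0, 4, 3, 2, 3, 4, 0, 3, 4, 1],
   ![0, 1, 2, 3, 2, 1, 0, 1, 2, 4],
   ![0, 4, 0, 4, 0, 1, 2, 3, 4, 3],
   ![0, 1, 0, 1, 0, 4, 3, 2, 1, 4],
   ![0, 4, 3, 2, 1, 0, 4, 0, 4, 1],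
   ![0, 1, 4, 0, 4, 3, 2, 3, 4, 1],
   ![0, 1, 2, 3, 2, 4, 3, 2, 1, 4],
   ![0, 4, 3, 2, 3, 4, 0, 1, 4, 1],
   ![0, 4, 1, 0, 4, 3, 2, 3, 4, 1],
   ![0, 1, 2, 3, 4, 2, 3, 2, 1, 4],
   ![0, 1, 2, 3, 2, 1, 0, 1, 4, 4],
   ![0, 3, 4, 0, 1, 2, 3, 2, 1, 4],
   ![0, 4, 3, 0, 1, 2, 3, 2, 1, 4],
   ![0, 4, 3, 2, 0, 1, 2, 3, 4, 1],
   ![0, 4, 3, 2, 1, 0, 2, 3, 4, 1],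
   ![0, 1, 2, 3, 2, 1, 0, 3, 4, 4],
   ![0, 1, 2, 3, 2, 1, 0, 4, 3, 4],
   ![0, 1, 2, 3, 4, 0, 1, 0, 4, 2],
   ![0, 1, 2, 3, 2, 3, 2, 3, 4, 1],
   ![0, 4, 3, 2, 3, 2, 3, 2, 1, 1]]

def LB1 : List (Fin 10 → Fin 5) :=
  [![0, 1, 0, 4, 3, 2, 1, 0, 1, 0],
   ![0, 1, 0, 0, 1, 2, 3, 2, 1, 4],
   ![2, 3, 4, 0, 4, 0, 0, 4, 3, 1],
   ![1, 0, 4, 3, 4, 0, 1, 0, 0, 2],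
   ![2, 3, 4, 0, 0, 4, 0, 4, 3, 1],
   ![0, 0, 1, 0, 1, 2, 3, 2, 1, 4],
   ![4, 3, 2, 1, 0, 4, 0, 4, 3, 0],
   ![1, 0, 0, 1, 2, 3, 4, 3, 2, 0],
   ![1, 2, 3, 4, 0, 0, 4, 3, 2, 0],
   ![4, 3, 2, 1, 2, 3, 4, 0, 0, 0]]

def LA2 : List (Fin 10 → Fin 5) :=
  [![0, 2, 1, 2, 1, 1, 0, 1, 3, 4],
   ![0, 4, 2, 3, 4, 3, 2, 1, 2, 3],
   ![0, 4, 0, 3, 4, 3, 2, 1, 4, 3],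
   ![0, 4, 0, 4, 1, 3, 2, 1, 0, 1],
   ![0, 1, 0, 4, 3, 2, 3, 4, 0, 4],
   ![0, 4, 3, 2, 1, 2, 3, 4, 3, 4],
   ![0, 4, 3, 2, 1, 3, 0, 4, 3, 4],
   ![0, 1, 2, 3, 4, 0, 1, 4, 4, 0],
   ![0, 4, 3, 2, 1, 0, 1, 2, 1, 0],
   ![0, 4, 3, 2, 1, 3, 2, 1, 3, 1],
   ![0, 4, 3, 2, 1, 3, 2, 1, 4, 3],
   ![0, 1, 2, 3, 4, 2, 3, 4, 4, 0],
   ![0, 4, 3, 2, 1, 3, 2, 1, 0, 1],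
   ![0, 4, 3, 2, 1, 3, 2, 1, 3, 4],
   ![0, 2, 1, 0, 4, 1, 2, 1, 4, 3],
   ![0, 1, 4, 0, 1, 2, 3, 4, 1, 2],
   ![0, 4, 3, 0, 1, 3, 2, 1, 4, 3],
   ![0, 4, 0, 1, 4, 3, 2, 1, 0, 1],
   ![0, 4, 0, 4, 3, 3, 2, 1, 0, 1],
   ![0, 4, 3, 2, 1, 1, 0, 1, 3, 4],
   ![0, 4, 3, 2, 1, 0, 3, 4, 1, 2],
   ![0, 1, 2, 3, 4, 0, 4, 1, 2, 3],
   ![0, 4, 3, 2, 1, 0, 4, 3, 1, 0],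
   ![0, 1, 2, 3, 4, 2, 3, 4, 4, 2]]

def LB2 : List (Fin 10 → Fin 5) :=
  [![0, 0, 1, 0, 1, 1, 2, 1, 4, 3],
   ![3, 4, 0, 0, 4, 0, 1, 2, 4, 0],
   ![3, 4, 0, 1, 2, 0, 0, 4, 0, 4],
   ![1, 2, 3, 4, 0, 3, 4, 0, 0, 0],
   ![0, 1, 0, 4, 0, 2, 3, 4, 0, 4],
   ![1, 2, 3, 4, 0, 1, 0, 0, 0, 1],
   ![3, 2, 1, 0, 4, 1, 0, 4, 0, 1],
   ![4, 0, 0, 4, 0, 1, 2, 3, 0, 1],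
   ![1, 2, 3, 4, 0, 3, 4, 0, 3, 0],
   ![2, 3, 4, 3, 0, 4, 0, 1, 2, 1],
   ![1, 2, 3, 4, 0, 0, 1, 2, 3, 2],
   ![2, 3, 4, 0, 1, 2, 3, 0, 1, 2]]

lemma Q1_R1 {a b : Fin 10} : s(a, b) ∈ Q1 ↔ ((a, b) ∈ R1 ∨ (b, a) ∈ R1) := by
  revert a b; decide +kernel

lemma Q2_R2 {a b : Fin 10} : s(a, b) ∈ Q2 ↔ ((a, b) ∈ R2 ∨ (b, a) ∈ R2) := by
  revert a b; decide +kernel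

def OkA (a b c : Fin 5) : Prop := ∃ t, A5 t a ∧ two t b ∧ t ≠ c
def OkB (a b c : Fin 5) : Prop := ∃ t, A5 t a ∧ t ≠ b ∧ t ≠ c
def OkC (a b c : Fin 5) : Prop := ∃ t, two t a ∧ two t b ∧ t ≠ c
instance (a b c : Fin 5) : Decidable (OkA a b c) := by unfold OkA; infer_instance
instance (a b c : Fin 5) : Decidable (OkB a b c) := by unfold OkB; infer_instance
instance (a b c : Fin 5) : Decidable (OkC a b c) := by unfold OkC; infer_instance

lemma okA_of : ∀ a b c, A5 a b → OkA a b c := by decide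
lemma okB_of : ∀ a b c, two a b → OkB a b c := by decide
lemma okC_of : ∀ a b c, two a b → OkC a b c := by decide

def FinA (Q : Finset (Sym2 (Fin 10))) (Ok : Fin 5 → Fin 5 → Fin 5 → Prop) : Prop :=
  ∀ i j k, s(i, j) ∈ Q → ∃ f : Fin 10 → Fin 5,
    (∀ a b, s(a, b) ∈ Q → s(a, b) ≠ s(i, j) → A5 (f a) (f b)) ∧ Ok (f i) (f j) (f k)

def FinB (Q : Finset (Sym2 (Fin 10))) (Ok : Fin 5 → Fin 5 → Fin 5 → Prop) : Prop :=
  ∀ w i j k, s(i, w) ∈ Q → s(w, j) ∈ Q → i ≠ j → k ≠ w → ∃ f : Fin 10 → Fin 5,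
    (∀ a b, s(a, b) ∈ Q → a ≠ w → b ≠ w → A5 (f a) (f b)) ∧ Ok (f i) (f j) (f k)

/-- `f` colours the listed edges except `p`. -/
def GdA (R : List (Fin 10 × Fin 10)) (f : Fin 10 → Fin 5) (p : Fin 10 × Fin 10) : Prop :=
  ∀ e ∈ R, e ≠ p → A5 (f e.1) (f e.2)
/-- `f` colours the listed edges avoiding `w`. -/
def GdB (R : List (Fin 10 × Fin 10)) (f : Fin 10 → Fin 5) (w : Fin 10) : Prop :=
  ∀ e ∈ R, e.1 ≠ w → e.2 ≠ w → A5 (f e.1) (f e.2)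
instance (R f p) : Decidable (GdA R f p) := by unfold GdA; infer_instance
instance (R f p) : Decidable (GdB R f p) := by unfold GdB; infer_instance

def WA (R : List (Fin 10 × Fin 10)) (L : List (Fin 10 → Fin 5)) (p : Fin 10 × Fin 10)
    (i j k : Fin 10) : Prop := ∃ f ∈ L, GdA R f p ∧ OkA (f i) (f j) (f k)
def WB (R : List (Fin 10 × Fin 10)) (L : List (Fin 10 → Fin 5)) (w i j k : Fin 10) : Prop :=
  ∃ f ∈ L, GdB R f w ∧ OkB (f i) (f j) (f k)
def WC (R : List (Fin 10 × Fin 10)) (L : List (Fin 10 → Fin 5)) (w i j k : Fin 10) : Prop :=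
  ∃ f ∈ L, GdB R f w ∧ OkC (f i) (f j) (f k)
instance (R L p i j k) : Decidable (WA R L p i j k) := List.decidableBEx _ L
instance (R L w i j k) : Decidable (WB R L w i j k) := List.decidableBEx _ L
instance (R L w i j k) : Decidable (WC R L w i j k) := List.decidableBEx _ L

lemma chkA1 : ∀ p ∈ R1, ∀ k, (WA R1 LA1 p p.1 p.2 k) ∧ (WA R1 LA1 p p.2 p.1 k) := by decide +kernel

lemma chkA2 : ∀ p ∈ R2, ∀ k, (WA R2 LA2 p p.1 p.2 k) ∧ (WA R2 LA2 p p.2 p.1 k) := by decide +kernel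

set_option synthInstance.maxSize 2000 in
set_option synthInstance.maxHeartbeats 200000 in
lemma chkB1 : ∀ w i j, ((i, w) ∈ R1 ∨ (w, i) ∈ R1) → ((w, j) ∈ R1 ∨ (j, w) ∈ R1) → i ≠ j →
    ∀ k, k ≠ w →
    (WB R1 LB1 w i j k) ∧
    (WC R1 LB1 w i j k) := by
  decide +kernel

set_option synthInstance.maxSize 2000 in
set_option synthInstance.maxHeartbeats 200000 in
lemma chkB2 : ∀ w i j, ((i, w) ∈ R2 ∨ (w, i) ∈ R2) → ((w, j) ∈ R2 ∨ (j, w) ∈ R2) → i ≠ j →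
    ∀ k, k ≠ w →
    (WB R2 LB2 w i j k) ∧
    (WC R2 LB2 w i j k) := by
  decide +kernel

lemma finA_of {Q : Finset (Sym2 (Fin 10))} {R : List (Fin 10 × Fin 10)}
    {L : List (Fin 10 → Fin 5)}
    (hQ : ∀ {a b}, s(a, b) ∈ Q ↔ ((a, b) ∈ R ∨ (b, a) ∈ R))
    (chk : ∀ p ∈ R, ∀ k, (WA R L p p.1 p.2 k) ∧ (WA R L p p.2 p.1 k)) : FinA Q OkA := by
  have aux : ∀ (f : Fin 10 → Fin 5) (p : Fin 10 × Fin 10),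
      (∀ e ∈ R, e ≠ p → A5 (f e.1) (f e.2)) →
      ∀ a b, s(a, b) ∈ Q → s(a, b) ≠ s(p.1, p.2) → A5 (f a) (f b) := by
    intro f p hf a b hab hne
    rcases hQ.1 hab with h | h
    · exact hf _ h (fun h' => hne (by rw [← h']))
    · exact (hf _ h (fun h' => hne (by rw [← h', Sym2.eq_swap]))).symm
  intro i j k hij
  rcases hQ.1 hij with h | h
  · obtain ⟨f, -, h1, h2⟩ := (chk _ h k).1
    exact ⟨f, aux f _ h1, h2⟩
  · obtain ⟨f, -, h1, h2⟩ := (chk _ h k).2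
    refine ⟨f, fun a b hab hne => aux f _ h1 a b hab ?_, h2⟩
    intro h'
    exact hne (by rw [h', Sym2.eq_swap])

lemma finA1 : FinA Q1 OkA := finA_of Q1_R1 chkA1
lemma finA2 : FinA Q2 OkA := finA_of Q2_R2 chkA2

lemma finB_of {Q : Finset (Sym2 (Fin 10))} {R : List (Fin 10 × Fin 10)}
    {L : List (Fin 10 → Fin 5)} {Ok : Fin 5 → Fin 5 → Fin 5 → Prop}
    (hQ : ∀ {a b}, s(a, b) ∈ Q ↔ ((a, b) ∈ R ∨ (b, a) ∈ R))
    (chk : ∀ w i j, ((i, w) ∈ R ∨ (w, i) ∈ R) → ((w, j) ∈ R ∨ (j, w) ∈ R) → i ≠ j →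
    ∀ k, k ≠ w →
    (∃ f ∈ L, (∀ e ∈ R, e.1 ≠ w → e.2 ≠ w → A5 (f e.1) (f e.2)) ∧ Ok (f i) (f j) (f k))) :
    FinB Q Ok := by
  intro w i j k hi hj hij hk
  obtain ⟨f, -, h1, h2⟩ := chk w i j (hQ.1 hi) (hQ.1 hj) hij k hk
  refine ⟨f, fun a b hab ha hb => ?_, h2⟩
  rcases hQ.1 hab with h | h
  · exact h1 _ h ha hb
  · exact (h1 _ h hb ha).symm

lemma finB1 : FinB Q1 OkB :=
  finB_of Q1_R1 (fun w i j h1 h2 h3 k h4 => (chkB1 w i j h1 h2 h3 k h4).1)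
lemma finB2 : FinB Q2 OkB :=
  finB_of Q2_R2 (fun w i j h1 h2 h3 k h4 => (chkB2 w i j h1 h2 h3 k h4).1)
lemma finC1 : FinB Q1 OkC :=
  finB_of Q1_R1 (fun w i j h1 h2 h3 k h4 => (chkB1 w i j h1 h2 h3 k h4).2)
lemma finC2 : FinB Q2 OkC :=
  finB_of Q2_R2 (fun w i j h1 h2 h3 k h4 => (chkB2 w i j h1 h2 h3 k h4).2)

/-! ## Reductions -/

lemma pend (E0 : Finset (Sym2 V)) (I : Finset V) (hE0 : ∀ a b, s(a, b) ∈ E0 → a ∉ I ∧ b ∉ I)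
    (hc : Col E0) (x w : V) (hx : x ∉ I) (hw : w ∈ I) : Col (insert s(x, w) E0) := by
  obtain ⟨f, hf⟩ := hc
  have hxw : x ≠ w := fun h => hx (h ▸ hw)
  have h1 : A5 (f x) (f x + 1) := by unfold A5; right; simp
  refine ⟨Function.update f w (f x + 1), fun a b hab => ?_⟩
  rcases Finset.mem_insert.1 hab with h | h
  · rw [Sym2.eq_iff] at h
    rcases h with ⟨rfl, rfl⟩ | ⟨rfl, rfl⟩
    · simpa [Function.update_of_ne hxw] using h1
    · simpa [Function.update_of_ne hxw] using h1.symm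
  · obtain ⟨ha, hb⟩ := hE0 a b h
    have haw : a ≠ w := fun h => ha (h ▸ hw)
    have hbw : b ≠ w := fun h => hb (h ▸ hw)
    rw [Function.update_of_ne haw, Function.update_of_ne hbw]
    exact hf a b h

lemma clrOff_ins {EG : Finset (Sym2 V)} {I : Finset V} {f : V → Fin 5} :
    ClrOff f EG I ↔ Clr f (ins EG Iᶜ) := by
  constructor
  · intro h a b hab
    obtain ⟨h1, h2, h3⟩ := mem_ins.1 hab
    exact h a b h1 (Finset.mem_compl.1 h2) (Finset.mem_compl.1 h3)
  · intro h a b hab ha hb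
    exact h a b (mem_ins.2 ⟨hab, Finset.mem_compl.2 ha, Finset.mem_compl.2 hb⟩)

lemma redA {EG : Finset (Sym2 V)} (C : Ctx EG) (I : Finset V) (x y z p1 p2 a b : V)
    (hx : x ∉ I) (hy : y ∉ I) (hz : z ∉ I) (hxy : x ≠ y)
    (h1 : p1 ∈ I) (h2 : p2 ∈ I) (ha : a ∈ I) (hb : b ∈ I)
    (d12 : p1 ≠ p2) (d1a : p1 ≠ a) (d1b : p1 ≠ b) (d2a : p2 ≠ a) (d2b : p2 ≠ b) (dab : a ≠ b)
    (e1 : s(x, p1) ∈ EG) (e2 : s(p1, p2) ∈ EG) (e3 : s(p2, y) ∈ EG)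
    (hcard : (ins EG Iᶜ).card + 6 ≤ EG.card)
    (hext : ∀ f, ClrOff f EG I → OkA (f x) (f y) (f z) → False)
    (hfive : ∀ w, w ∉ I → s(x, w) ∈ EG → s(w, y) ∈ EG → False) : False := by
  set E0 := ins EG Iᶜ with hE0
  have hE0I : ∀ a b, s(a, b) ∈ E0 → a ∉ I ∧ b ∉ I := by
    intro a b hab
    obtain ⟨-, h2, h3⟩ := mem_ins.1 hab
    exact ⟨Finset.mem_compl.1 h2, Finset.mem_compl.1 h3⟩
  have hE0sub : E0 ⊆ EG := Finset.filter_subset _ _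
  have hE0col : Col E0 := C.crit _ ⟨hE0sub, fun h => (hE0I _ _ (h e1)).2 h1⟩
  have hFnc : ¬ Col (insert s(x, y) E0) := by
    rintro ⟨f, hf⟩
    refine hext f (clrOff_ins.2 fun a b hab => hf a b (Finset.mem_insert_of_mem hab)) ?_
    exact okA_of _ _ _ (hf x y (Finset.mem_insert_self _ _))
  obtain ⟨K, hKF, hK⟩ := exists_minU _ hFnc
  have hxyK : s(x, y) ∈ K := by
    by_contra hn
    apply hK.1
    refine Col.mono ?_ hE0col
    intro e he
    rcases Finset.mem_insert.1 (hKF he) with h | h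
    · exact absurd (h ▸ he) hn
    · exact h
  have hKI : ∀ u ∈ spt K, u ∉ I := by
    intro u hu
    obtain ⟨v, hv⟩ := mem_spt.1 hu
    rcases Finset.mem_insert.1 (hKF hv) with h | h
    · rw [Sym2.eq_iff] at h
      rcases h with ⟨rfl, rfl⟩ | ⟨rfl, rfl⟩ <;> assumption
    · exact (hE0I _ _ h).1
  have hKE0 : K.erase s(x, y) ⊆ E0 := by
    intro e he
    obtain ⟨g1, g2⟩ := Finset.mem_erase.1 he
    rcases Finset.mem_insert.1 (hKF g2) with h | h
    · exact absurd h g1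
    · exact h
  have hnd : ND K := by
    intro u hu
    rcases Finset.mem_insert.1 (hKF hu) with h | h
    · rw [Sym2.eq_iff] at h
      rcases h with ⟨rfl, h⟩ | ⟨rfl, h⟩
      · exact hxy h
      · exact hxy h.symm
    · exact C.nd _ (hE0sub h)
  have hpos : 0 < K.card := Finset.card_pos.2 ⟨_, hxyK⟩
  have hKe : (K.erase s(x, y)).card = K.card - 1 := Finset.card_erase_of_mem hxyK
  -- extended subgraph
  let S := insert p1 (insert p2 (spt K))
  have n2 : p2 ∉ spt K := fun h => hKI _ h h2
  have n1 : p1 ∉ insert p2 (spt K) := by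
    rw [Finset.mem_insert]; rintro (h | h)
    · exact d12 h
    · exact hKI _ h h1
  have hScard : S.card = (spt K).card + 2 := by
    rw [Finset.card_insert_of_notMem n1, Finset.card_insert_of_notMem n2]
  have na : a ∉ S := by
    simp only [S, Finset.mem_insert, not_or]
    exact ⟨d1a.symm, d2a.symm, fun h => hKI _ h ha⟩
  have nb : b ∉ S := by
    simp only [S, Finset.mem_insert, not_or]
    exact ⟨d1b.symm, d2b.symm, fun h => hKI _ h hb⟩
  let H := insert s(x, p1) (insert s(p1, p2) (insert s(p2, y) (K.erase s(x, y))))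
  have x1 : x ≠ p1 := fun h => hx (h ▸ h1)
  have x2 : x ≠ p2 := fun h => hx (h ▸ h2)
  have y1 : y ≠ p1 := fun h => hy (h ▸ h1)
  have y2 : y ≠ p2 := fun h => hy (h ▸ h2)
  have m3 : s(p2, y) ∉ K.erase s(x, y) := fun h => (hE0I _ _ (hKE0 h)).1 h2
  have m2 : s(p1, p2) ∉ insert s(p2, y) (K.erase s(x, y)) := by
    rw [Finset.mem_insert, Sym2.eq_iff]
    rintro ((⟨h, -⟩ | ⟨h, -⟩) | h)
    · exact d12 h
    · exact y1 h.symm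
    · exact (hE0I _ _ (hKE0 h)).1 h1
  have m1 : s(x, p1) ∉ insert s(p1, p2) (insert s(p2, y) (K.erase s(x, y))) := by
    rw [Finset.mem_insert, Finset.mem_insert, Sym2.eq_iff, Sym2.eq_iff]
    rintro ((⟨h, -⟩ | ⟨h, -⟩) | (⟨h, -⟩ | ⟨h, -⟩) | h)
    · exact x1 h
    · exact x2 h
    · exact x2 h
    · exact hxy h
    · exact (hE0I _ _ (hKE0 h)).2 h1
  have hHcard : H.card = K.card + 2 := by
    rw [Finset.card_insert_of_notMem m1, Finset.card_insert_of_notMem m2,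
      Finset.card_insert_of_notMem m3, hKe]
    omega
  have hHsub : H ⊆ EG := by
    intro e he
    simp only [H, Finset.mem_insert] at he
    rcases he with rfl | rfl | rfl | h
    · exact e1
    · exact e2
    · exact e3
    · exact hE0sub (hKE0 h)
  have xS : x ∈ S := by simp [S, mem_spt_left hxyK]
  have yS : y ∈ S := by simp [S, mem_spt_right hxyK]
  have pS1 : p1 ∈ S := by simp [S]
  have pS2 : p2 ∈ S := by simp [S]
  have hHS : ∀ u v, s(u, v) ∈ H → u ∈ S ∧ v ∈ S := by
    intro u v huv
    simp only [H, Finset.mem_insert, Sym2.eq_iff] at huv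
    rcases huv with (⟨rfl, rfl⟩ | ⟨rfl, rfl⟩) | (⟨rfl, rfl⟩ | ⟨rfl, rfl⟩) |
      (⟨rfl, rfl⟩ | ⟨rfl, rfl⟩) | h
    any_goals constructor <;> assumption
    have h' := (Finset.mem_erase.1 h).2
    exact ⟨by simp [S, mem_spt_left h'], by simp [S, mem_spt_right h']⟩
  have hSu : S ≠ Finset.univ := fun h => na (h ▸ Finset.mem_univ a)
  have hpot := potential' C S H hHsub hHS ⟨x, xS⟩ hSu
  have hlt : (spt K).card < Fintype.card V := by
    have : S.card ≤ Fintype.card V := Finset.card_le_univ _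
    omega
  have fin : ∀ Q : Finset (Sym2 (Fin 10)), Q.card = 12 → (∀ i, ∃ j, s(i, j) ∈ Q) →
      FinA Q OkA → Copy Q K → False := by
    rintro Q hQ hcov hfin ⟨ι, hι, hKeq⟩
    have c1 := copy_spt_card hι hcov
    have c2 := copy_card (Q := Q) hι
    have c3 := copy_spt hι hcov
    rw [← hKeq] at c1 c2 c3
    have hn : S.card + 2 = Fintype.card V := hpot.2 (by omega)
    have huniv : insert a (insert b S) = Finset.univ := by
      rw [← Finset.card_eq_iff_eq_univ, Finset.card_insert_of_notMem,
        Finset.card_insert_of_notMem nb, hn]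
      rw [Finset.mem_insert, not_or]; exact ⟨dab, na⟩
    have hp := C.pot
    have hE0eq : K.erase s(x, y) = E0 := by
      apply Finset.eq_of_subset_of_card_le hKE0
      omega
    have hzK : z ∈ spt K := by
      have hz' := Finset.mem_univ z
      rw [← huniv] at hz'
      simp only [S, Finset.mem_insert] at hz'
      rcases hz' with rfl | rfl | rfl | rfl | h
      · exact absurd ha hz
      · exact absurd hb hz
      · exact absurd h1 hz
      · exact absurd h2 hz
      · exact h
    rw [c3] at hzK
    obtain ⟨k, -, hk⟩ := Finset.mem_image.1 hzK
    have hxyK' := hxyK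
    rw [hKeq] at hxyK'
    obtain ⟨i, j, hi, hj, hij⟩ := copy_exists hxyK'
    obtain ⟨f, hf1, hf2⟩ := hfin i j k hij
    have hval : ∀ t, Function.extend ι f 0 (ι t) = f t := fun t => hι.extend_apply f 0 t
    refine hext (Function.extend ι f 0) (clrOff_ins.2 ?_) ?_
    · rw [← hE0, ← hE0eq]
      intro u v huv
      obtain ⟨g1, g2⟩ := Finset.mem_erase.1 huv
      rw [hKeq] at g2
      obtain ⟨i', j', rfl, rfl, hij'⟩ := copy_exists g2
      rw [hval, hval]
      apply hf1 _ _ hij'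
      intro heq
      apply g1
      rw [← hi, ← hj]
      have := congrArg (Sym2.map ι) heq
      simpa using this
    · rw [← hi, ← hj, ← hk, hval, hval, hval]
      exact hf2
  rcases C.min K hnd hK hlt with h | h | h | h
  · omega
  · obtain ⟨w, hwK, hwx, hwy⟩ : ∃ w ∈ spt K, w ≠ x ∧ w ≠ y := by
      by_contra hcon
      push Not at hcon
      have hsub : spt K ⊆ {x, y} := by
        intro w hw
        rw [Finset.mem_insert, Finset.mem_singleton]
        by_cases hwx : w = x
        · exact Or.inl hwx
        · exact Or.inr (hcon w hw hwx)
      have g1 := Finset.card_le_card hsub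
      have g2 : ({x, y} : Finset V).card ≤ 2 := Finset.card_le_two
      obtain ⟨ι, hι, hKeq⟩ := h
      have c1 := copy_spt_card hι T3_cov
      rw [← hKeq] at c1
      omega
    have k1 := T3_copy_complete h (mem_spt_left hxyK) hwK hwx.symm
    have k2 := T3_copy_complete h hwK (mem_spt_right hxyK) hwy
    refine hfive w (hKI w hwK) (hE0sub (hKE0 (Finset.mem_erase.2 ⟨?_, k1⟩)))
      (hE0sub (hKE0 (Finset.mem_erase.2 ⟨?_, k2⟩)))
    · rw [Ne, Sym2.eq_iff]
      rintro (⟨-, h⟩ | ⟨h, -⟩)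
      · exact hwy h
      · exact hxy h
    · rw [Ne, Sym2.eq_iff]
      rintro (⟨h, -⟩ | ⟨h, -⟩)
      · exact hwx h
      · exact hwy h
  · exact fin Q1 Q1_card Q1_cov finA1 h
  · exact fin Q2 Q2_card Q2_cov finA2 h

lemma redB {EG : Finset (Sym2 V)} (C : Ctx EG) (Ok : Fin 5 → Fin 5 → Fin 5 → Prop)
    (hOk : ∀ a b c, two a b → Ok a b c) (fin1 : FinB Q1 Ok) (fin2 : FinB Q2 Ok)
    (I : Finset V) (x y z p1 p2 p3 a b : V)
    (hx : x ∉ I) (hy : y ∉ I) (hz : z ∉ I) (hxy : x ≠ y)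
    (h1 : p1 ∈ I) (h2 : p2 ∈ I) (h3 : p3 ∈ I) (ha : a ∈ I) (hb : b ∈ I)
    (d12 : p1 ≠ p2) (d13 : p1 ≠ p3) (d23 : p2 ≠ p3)
    (d1a : p1 ≠ a) (d1b : p1 ≠ b) (d2a : p2 ≠ a) (d2b : p2 ≠ b)
    (d3a : p3 ≠ a) (d3b : p3 ≠ b) (dab : a ≠ b)
    (e1 : s(x, p1) ∈ EG) (e2 : s(p1, p2) ∈ EG) (e3 : s(p2, p3) ∈ EG) (e4 : s(p3, y) ∈ EG)
    (hcard : (ins EG Iᶜ).card + 7 ≤ EG.card)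
    (hext : ∀ f, ClrOff f EG I → Ok (f x) (f y) (f z) → False)
    (hfive : s(x, y) ∉ EG) : False := by
  set E0 := ins EG Iᶜ with hE0
  have hE0I : ∀ a b, s(a, b) ∈ E0 → a ∉ I ∧ b ∉ I := by
    intro a b hab
    obtain ⟨-, h2, h3⟩ := mem_ins.1 hab
    exact ⟨Finset.mem_compl.1 h2, Finset.mem_compl.1 h3⟩
  have hE0sub : E0 ⊆ EG := Finset.filter_subset _ _
  have hE0col : Col E0 := C.crit _ ⟨hE0sub, fun h => (hE0I _ _ (h e1)).2 h1⟩
  have x1 : x ≠ p1 := fun h => hx (h ▸ h1)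
  have x2 : x ≠ p2 := fun h => hx (h ▸ h2)
  have x3 : x ≠ p3 := fun h => hx (h ▸ h3)
  have y1 : y ≠ p1 := fun h => hy (h ▸ h1)
  have y2 : y ≠ p2 := fun h => hy (h ▸ h2)
  have y3 : y ≠ p3 := fun h => hy (h ▸ h3)
  have hFnc : ¬ Col (insert s(x, p2) (insert s(y, p2) E0)) := by
    rintro ⟨f, hf⟩
    refine hext f (clrOff_ins.2 fun a b hab => hf a b
      (Finset.mem_insert_of_mem (Finset.mem_insert_of_mem hab))) ?_
    have g1 := hf x p2 (by simp)
    have g2 := hf y p2 (by simp)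
    apply hOk
    revert g1 g2
    generalize f x = c1
    generalize f y = c2
    generalize f p2 = c3
    revert c1 c2 c3
    decide
  obtain ⟨K, hKF, hK⟩ := exists_minU _ hFnc
  have hKc : ∀ e ∈ K, e = s(x, p2) ∨ e = s(y, p2) ∨ e ∈ E0 := by
    intro e he
    simpa using hKF he
  have hxK : s(x, p2) ∈ K := by
    by_contra hn
    apply hK.1
    refine Col.mono ?_ (pend E0 I hE0I hE0col y p2 hy h2)
    intro e he
    rcases hKc e he with h | h | h
    · exact absurd (h ▸ he) hn
    · simp [h]
    · simp [h]
  have hyK : s(y, p2) ∈ K := by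
    by_contra hn
    apply hK.1
    refine Col.mono ?_ (pend E0 I hE0I hE0col x p2 hx h2)
    intro e he
    rcases hKc e he with h | h | h
    · simp [h]
    · exact absurd (h ▸ he) hn
    · simp [h]
  have hKI : ∀ u ∈ spt K, u ≠ p2 → u ∉ I := by
    intro u hu hu2
    obtain ⟨v, hv⟩ := mem_spt.1 hu
    rcases hKc _ hv with h | h | h
    · rw [Sym2.eq_iff] at h
      rcases h with ⟨rfl, rfl⟩ | ⟨rfl, rfl⟩
      · assumption
      · exact absurd rfl hu2
    · rw [Sym2.eq_iff] at h
      rcases h with ⟨rfl, rfl⟩ | ⟨rfl, rfl⟩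
      · assumption
      · exact absurd rfl hu2
    · exact (hE0I _ _ h).1
  have hnd : ND K := by
    intro u hu
    rcases hKc _ hu with h | h | h
    · rw [Sym2.eq_iff] at h
      rcases h with ⟨rfl, h⟩ | ⟨rfl, h⟩
      · exact x2 h
      · exact x2 h.symm
    · rw [Sym2.eq_iff] at h
      rcases h with ⟨rfl, h⟩ | ⟨rfl, h⟩
      · exact y2 h
      · exact y2 h.symm
    · exact C.nd _ (hE0sub h)
  have hne2 : s(y, p2) ≠ s(x, p2) := by
    rw [Ne, Sym2.eq_iff]
    rintro (⟨h, -⟩ | ⟨h, -⟩)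
    · exact hxy h.symm
    · exact y2 h
  let K0 := (K.erase s(x, p2)).erase s(y, p2)
  have hyK' : s(y, p2) ∈ K.erase s(x, p2) := Finset.mem_erase.2 ⟨hne2, hyK⟩
  have hK0card : K0.card + 2 = K.card := by
    have g1 := Finset.card_erase_add_one hxK
    have g2 : K0.card + 1 = _ := Finset.card_erase_add_one hyK'
    omega
  have hK0K : K0 ⊆ K := (Finset.erase_subset _ _).trans (Finset.erase_subset _ _)
  have hKE0 : K0 ⊆ E0 := by
    intro e he
    obtain ⟨g1, g2⟩ := Finset.mem_erase.1 he
    obtain ⟨g3, g4⟩ := Finset.mem_erase.1 g2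
    rcases hKc e g4 with h | h | h
    · exact absurd h g3
    · exact absurd h g1
    · exact h
  -- extended subgraph
  let S := insert p1 (insert p3 (spt K))
  have n2 : p3 ∉ spt K := fun h => hKI _ h d23.symm h3
  have n1 : p1 ∉ insert p3 (spt K) := by
    rw [Finset.mem_insert]; rintro (h | h)
    · exact d13 h
    · exact hKI _ h d12 h1
  have hScard : S.card = (spt K).card + 2 := by
    rw [Finset.card_insert_of_notMem n1, Finset.card_insert_of_notMem n2]
  have na : a ∉ S := by
    simp only [S, Finset.mem_insert, not_or]
    exact ⟨d1a.symm, d3a.symm, fun h => hKI _ h d2a.symm ha⟩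
  have nb : b ∉ S := by
    simp only [S, Finset.mem_insert, not_or]
    exact ⟨d1b.symm, d3b.symm, fun h => hKI _ h d2b.symm hb⟩
  let H := insert s(x, p1) (insert s(p1, p2) (insert s(p2, p3) (insert s(p3, y) K0)))
  have m4 : s(p3, y) ∉ K0 := fun h => (hE0I _ _ (hKE0 h)).1 h3
  have m3 : s(p2, p3) ∉ insert s(p3, y) K0 := by
    rw [Finset.mem_insert, Sym2.eq_iff]
    rintro ((⟨h, -⟩ | ⟨h, -⟩) | h)
    · exact d23 h
    · exact y2 h.symm
    · exact (hE0I _ _ (hKE0 h)).1 h2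
  have m2 : s(p1, p2) ∉ insert s(p2, p3) (insert s(p3, y) K0) := by
    rw [Finset.mem_insert, Finset.mem_insert, Sym2.eq_iff, Sym2.eq_iff]
    rintro ((⟨h, -⟩ | ⟨h, -⟩) | (⟨h, -⟩ | ⟨h, -⟩) | h)
    · exact d12 h
    · exact d13 h
    · exact d13 h
    · exact y1 h.symm
    · exact (hE0I _ _ (hKE0 h)).1 h1
  have m1 : s(x, p1) ∉ insert s(p1, p2) (insert s(p2, p3) (insert s(p3, y) K0)) := by
    rw [Finset.mem_insert, Finset.mem_insert, Finset.mem_insert, Sym2.eq_iff, Sym2.eq_iff,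
      Sym2.eq_iff]
    rintro ((⟨h, -⟩ | ⟨h, -⟩) | (⟨h, -⟩ | ⟨h, -⟩) | (⟨h, -⟩ | ⟨h, -⟩) | h)
    · exact x1 h
    · exact x2 h
    · exact x2 h
    · exact x3 h
    · exact x3 h
    · exact hxy h
    · exact (hE0I _ _ (hKE0 h)).2 h1
  have hHcard : H.card = K.card + 2 := by
    rw [Finset.card_insert_of_notMem m1, Finset.card_insert_of_notMem m2,
      Finset.card_insert_of_notMem m3, Finset.card_insert_of_notMem m4]
    omega
  have hHsub : H ⊆ EG := by
    intro e he
    simp only [H, Finset.mem_insert] at he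
    rcases he with rfl | rfl | rfl | rfl | h
    · exact e1
    · exact e2
    · exact e3
    · exact e4
    · exact hE0sub (hKE0 h)
  have xS : x ∈ S := by simp [S, mem_spt_left hxK]
  have yS : y ∈ S := by simp [S, mem_spt_left hyK]
  have pS1 : p1 ∈ S := by simp [S]
  have pS2 : p2 ∈ S := by simp [S, mem_spt_right hxK]
  have pS3 : p3 ∈ S := by simp [S]
  have hHS : ∀ u v, s(u, v) ∈ H → u ∈ S ∧ v ∈ S := by
    intro u v huv
    simp only [H, Finset.mem_insert, Sym2.eq_iff] at huv
    rcases huv with (⟨rfl, rfl⟩ | ⟨rfl, rfl⟩) | (⟨rfl, rfl⟩ | ⟨rfl, rfl⟩) |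
      (⟨rfl, rfl⟩ | ⟨rfl, rfl⟩) | (⟨rfl, rfl⟩ | ⟨rfl, rfl⟩) | h
    any_goals constructor <;> assumption
    have h' := hK0K h
    exact ⟨by simp [S, mem_spt_left h'], by simp [S, mem_spt_right h']⟩
  have hSu : S ≠ Finset.univ := fun h => na (h ▸ Finset.mem_univ a)
  have hpot := potential' C S H hHsub hHS ⟨x, xS⟩ hSu
  have hlt : (spt K).card < Fintype.card V := by
    have : S.card ≤ Fintype.card V := Finset.card_le_univ _
    omega
  have fin : ∀ Q : Finset (Sym2 (Fin 10)), Q.card = 12 → (∀ i, ∃ j, s(i, j) ∈ Q) →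
      FinB Q Ok → Copy Q K → False := by
    rintro Q hQ hcov hfin ⟨ι, hι, hKeq⟩
    have c1 := copy_spt_card hι hcov
    have c2 := copy_card (Q := Q) hι
    have c3 := copy_spt hι hcov
    rw [← hKeq] at c1 c2 c3
    have hn : S.card + 2 = Fintype.card V := hpot.2 (by omega)
    have huniv : insert a (insert b S) = Finset.univ := by
      rw [← Finset.card_eq_iff_eq_univ, Finset.card_insert_of_notMem,
        Finset.card_insert_of_notMem nb, hn]
      rw [Finset.mem_insert, not_or]; exact ⟨dab, na⟩
    have hp := C.pot
    have hE0eq : K0 = E0 := by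
      apply Finset.eq_of_subset_of_card_le hKE0
      omega
    have hzK : z ∈ spt K := by
      have hz' := Finset.mem_univ z
      rw [← huniv] at hz'
      simp only [S, Finset.mem_insert] at hz'
      rcases hz' with rfl | rfl | rfl | rfl | h
      · exact absurd ha hz
      · exact absurd hb hz
      · exact absurd h1 hz
      · exact absurd h3 hz
      · exact h
    rw [c3] at hzK
    obtain ⟨k, -, hk⟩ := Finset.mem_image.1 hzK
    have hxK' := hxK
    rw [hKeq] at hxK'
    obtain ⟨i, w, hi, hw, hiw⟩ := copy_exists hxK'
    have hyK'' := hyK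
    rw [hKeq] at hyK''
    obtain ⟨j, w', hj, hw', hjw⟩ := copy_exists hyK''
    have hww : w' = w := hι (hw'.trans hw.symm)
    subst hww
    have hij : i ≠ j := by
      rintro rfl
      exact hxy (hi.symm.trans hj)
    have hkw : k ≠ w' := by
      rintro rfl
      rw [hw] at hk
      exact hz (hk ▸ h2)
    obtain ⟨f, hf1, hf2⟩ := hfin w' i j k hiw (by rwa [Sym2.eq_swap]) hij hkw
    have hval : ∀ t, Function.extend ι f 0 (ι t) = f t := fun t => hι.extend_apply f 0 t
    refine hext (Function.extend ι f 0) (clrOff_ins.2 ?_) ?_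
    · rw [← hE0, ← hE0eq]
      intro u v huv
      have g2 := hK0K huv
      have g3 := hE0I _ _ (hKE0 huv)
      rw [hKeq] at g2
      obtain ⟨i', j', rfl, rfl, hij'⟩ := copy_exists g2
      rw [hval, hval]
      apply hf1 _ _ hij'
      · rintro rfl
        exact g3.1 (hw ▸ h2)
      · rintro rfl
        exact g3.2 (hw ▸ h2)
    · rw [← hi, ← hj, ← hk, hval, hval, hval]
      exact hf2
  rcases C.min K hnd hK hlt with h | h | h | h
  · omega
  · have k1 := T3_copy_complete h (mem_spt_left hxK) (mem_spt_left hyK) hxy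
    rcases hKc _ k1 with h | h | h
    · rw [Sym2.eq_iff] at h
      rcases h with ⟨-, h⟩ | ⟨h, -⟩
      · exact y2 h
      · exact x2 h
    · rw [Sym2.eq_iff] at h
      rcases h with ⟨h, -⟩ | ⟨h, -⟩
      · exact hxy h
      · exact x2 h
    · exact hfive (hE0sub h)
  · exact fin Q1 Q1_card Q1_cov fin1 h
  · exact fin Q2 Q2_card Q2_cov fin2 h

/-! ## Extension of colourings -/

lemma step {E : Finset (Sym2 V)} (hnd : ND E) {f : V → Fin 5} {I : Finset V} {m : V} (t : Fin 5)
    (hf : ClrOff f E (insert m I))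
    (ht : ∀ u, s(m, u) ∈ E → u ∉ I → A5 t (f u)) : ClrOff (Function.update f m t) E I := by
  intro a b hab ha hb
  by_cases ham : a = m
  · subst ham
    have hba : b ≠ a := by
      rintro rfl; exact hnd _ hab
    rw [Function.update_self, Function.update_of_ne hba]
    exact ht b hab hb
  · by_cases hbm : b = m
    · subst hbm
      rw [Function.update_self, Function.update_of_ne ham]
      exact (ht a (by rwa [Sym2.eq_swap]) ha).symm
    · rw [Function.update_of_ne ham, Function.update_of_ne hbm]
      exact hf a b hab (by simp [ham, ha]) (by simp [hbm, hb])

lemma str1 {E : Finset (Sym2 V)} (hnd : ND E) {f : V → Fin 5} {I : Finset V} {m p q : V}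
    (hN : ∀ u, s(m, u) ∈ E → u = p ∨ u = q) (hf : ClrOff f E (insert m I))
    (h2 : two (f p) (f q)) :
    ∃ f', ClrOff f' E I ∧ ∀ u, u ≠ m → f' u = f u := by
  obtain ⟨c, h1, h3⟩ := two_mid _ _ h2
  refine ⟨Function.update f m c, step hnd c hf ?_, fun u hu => Function.update_of_ne hu _ _⟩
  intro u hu _
  rcases hN u hu with rfl | rfl <;> assumption

lemma str2 {E : Finset (Sym2 V)} (hnd : ND E) {f : V → Fin 5} {I : Finset V} {a b v z : V}
    (hNa : ∀ u, s(a, u) ∈ E → u = v ∨ u = b) (hNb : ∀ u, s(b, u) ∈ E → u = a ∨ u = z)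
    (hza : z ≠ a) (hf : ClrOff f E (insert a (insert b I)))
    (hne : f v ≠ f z) :
    ∃ f', ClrOff f' E I ∧ ∀ u, u ≠ a → u ≠ b → f' u = f u := by
  obtain ⟨c, d, h1, h2, h3⟩ := ne_mid _ _ hne
  refine ⟨Function.update (Function.update f a c) b d, step hnd d (step hnd c hf ?_) ?_, ?_⟩
  · intro u hu hub
    rcases hNa u hu with rfl | rfl
    · exact h1
    · simp at hub
  · intro u hu _
    rcases hNb u hu with rfl | rfl
    · rw [Function.update_self]; exact h2.symm
    · rw [Function.update_of_ne hza]; exact h3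
  · intro u hua hub
    rw [Function.update_of_ne hub, Function.update_of_ne hua]

lemma colOff {E : Finset (Sym2 V)} (C : Ctx E) (I : Finset V) (m : V) (hm : m ∈ I) :
    ∃ f, ClrOff f E I := by
  have hss : ins E Iᶜ ⊂ E := by
    refine ⟨Finset.filter_subset _ _, fun h => ?_⟩
    obtain ⟨u, hu⟩ := C.cov m
    exact (Finset.mem_compl.1 (mem_ins.1 (h hu)).2.1) hm
  obtain ⟨f, hf⟩ := C.crit _ hss
  exact ⟨f, clrOff_ins.2 hf⟩

lemma col_of_off {E : Finset (Sym2 V)} {f : V → Fin 5} (h : ClrOff f E ∅) : Col E :=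
  ⟨f, fun a b hab => h a b hab (by simp) (by simp)⟩

lemma cardOff {E : Finset (Sym2 V)} (I : Finset V) (L : List (Sym2 V)) (hL : L.Nodup)
    (hE : ∀ e ∈ L, e ∈ E) (hI : ∀ e ∈ L, ∃ v ∈ e, v ∈ I) :
    (ins E Iᶜ).card + L.length ≤ E.card := by
  rw [← List.toFinset_card_of_nodup hL, ← Finset.card_union_of_disjoint]
  · apply Finset.card_le_card
    intro e he
    rcases Finset.mem_union.1 he with h | h
    · exact Finset.filter_subset _ _ h
    · exact hE e (List.mem_toFinset.1 h)
  · rw [Finset.disjoint_left]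
    intro e he he'
    obtain ⟨v, hv, hvI⟩ := hI e (List.mem_toFinset.1 he')
    have := (Finset.mem_filter.1 he).2 v hv
    exact (Finset.mem_compl.1 this) hvI

/-- A string of length two starting in `v`. -/
structure S1 (E : Finset (Sym2 V)) (T : V → Prop) (v m u : V) : Prop where
  e1 : s(v, m) ∈ E
  e2 : s(m, u) ∈ E
  tm : ¬ T m
  tu : T u
  vu : v ≠ u
  N : ∀ w, s(m, w) ∈ E → w = v ∨ w = u

/-- A string of length three starting in `v`. -/
structure S2 (E : Finset (Sym2 V)) (T : V → Prop) (v a b u : V) : Prop where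
  e1 : s(v, a) ∈ E
  e2 : s(a, b) ∈ E
  e3 : s(b, u) ∈ E
  ta : ¬ T a
  tb : ¬ T b
  tu : T u
  ab : a ≠ b
  vu : v ≠ u
  Na : ∀ w, s(a, w) ∈ E → w = v ∨ w = b
  Nb : ∀ w, s(b, w) ∈ E → w = a ∨ w = u

lemma tne {T : V → Prop} {x y : V} (hx : T x) (hy : ¬ T y) : x ≠ y := fun h => hy (h ▸ hx)

lemma S2.ne_b {E : Finset (Sym2 V)} {T : V → Prop} {v a b u m : V} (h : S2 E T v a b u)
    (hv : T v) (hm : s(v, m) ∈ E) : m ≠ b := by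
  rintro rfl
  rcases h.Nb v (by rwa [Sym2.eq_swap]) with h' | h'
  · exact h.ta (h' ▸ hv)
  · exact h.vu h'

lemma S2.bb {E : Finset (Sym2 V)} {T : V → Prop} {v a b u c d w : V} (h : S2 E T v a b u)
    (h' : S2 E T v c d w) (hac : a ≠ c) : b ≠ d := by
  rintro rfl
  rcases h'.Nb a (by rw [Sym2.eq_swap]; exact h.e2) with g | g
  · exact hac g
  · exact h.ta (g ▸ h'.tu)

/-- `v` lies on no 5-cycle. -/
def NoFive (E : Finset (Sym2 V)) (v : V) : Prop :=
  ∀ p q r t, s(v, p) ∈ E → s(p, q) ∈ E → s(q, r) ∈ E → s(r, t) ∈ E → s(t, v) ∈ E →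
    [v, p, q, r, t].Nodup → False

lemma caseA {E : Finset (Sym2 V)} (C : Ctx E) (T : V → Prop) {v x m y a b z : V} (hv : T v)
    (hx : T x) (ex : s(v, x) ∈ E) (hm : S1 E T v m y) (ha : S2 E T v a b z) (hma : m ≠ a)
    (hN : ∀ w, s(v, w) ∈ E → w = x ∨ w = m ∨ w = a) (h5 : NoFive E v) : False := by
  have hmb : m ≠ b := ha.ne_b hv hm.e1
  have vx : v ≠ x := by rintro rfl; exact C.nd _ ex
  have vm := tne hv hm.tm
  have va := tne hv ha.ta
  have vb := tne hv ha.tb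
  have xm := tne hx hm.tm
  have xa := tne hx ha.ta
  have xb := tne hx ha.tb
  have ym := tne hm.tu hm.tm
  have ya := tne hm.tu ha.ta
  have yb := tne hm.tu ha.tb
  have zm := tne ha.tu hm.tm
  have za := tne ha.tu ha.ta
  have zb := tne ha.tu ha.tb
  have vy := hm.vu
  have vz := ha.vu
  have ab := ha.ab
  have xy : x ≠ y := by
    rintro rfl
    exact C.notri v m x hm.e1 hm.e2 ex
  refine redA C {v, m, a, b} x y z v m a b ?_ ?_ ?_ xy ?_ ?_ ?_ ?_ vm va vb hma hmb ab
    (by rw [Sym2.eq_swap]; exact ex) hm.e1 hm.e2 ?_ ?_ ?_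
  · simp [vx.symm, xm, xa, xb]
  · simp [vy.symm, ym, ya, yb]
  · simp [vz.symm, zm, za, zb]
  · simp
  · simp
  · simp
  · simp
  · refine cardOff _ [s(v, x), s(v, m), s(m, y), s(v, a), s(a, b), s(b, z)] ?_ ?_ ?_
    · simp only [List.nodup_cons, List.mem_cons, Sym2.eq_iff, List.not_mem_nil, List.nodup_nil]
      grind
    · simp [ex, hm.e1, hm.e2, ha.e1, ha.e2, ha.e3]
    · simp
  · rintro f hf ⟨t, t1, t2, t3⟩
    have g1 := step C.nd t hf (by
      intro u hu huI
      rcases hN u hu with rfl | rfl | rfl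
      · exact t1
      · simp at huI
      · simp at huI)
    obtain ⟨f2, g2, k2⟩ := str1 C.nd hm.N g1 (by
      rw [Function.update_self, Function.update_of_ne vy.symm]; exact t2)
    obtain ⟨f3, g3, -⟩ := str2 (I := ∅) C.nd ha.Na ha.Nb za g2 (by
      rw [k2 v vm, k2 z zm, Function.update_self, Function.update_of_ne vz.symm]; exact t3)
    exact C.ncol (col_of_off g3)
  · intro w hw w1 w2
    simp only [Finset.mem_insert, Finset.mem_singleton, not_or] at hw
    have wx : w ≠ x := by rintro rfl; exact C.nd _ w1
    have wy : w ≠ y := by rintro rfl; exact C.nd _ w2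
    refine h5 x w y m ex w1 w2 (by rw [Sym2.eq_swap]; exact hm.e2)
      (by rw [Sym2.eq_swap]; exact hm.e1) ?_
    simp only [List.nodup_cons, List.mem_cons, List.not_mem_nil, List.nodup_nil]
    grind

lemma caseB {E : Finset (Sym2 V)} (C : Ctx E) (T : V → Prop) {v x c d y a b z : V} (hv : T v)
    (hx : T x) (ex : s(v, x) ∈ E) (hc : S2 E T v c d y) (ha : S2 E T v a b z) (hca : c ≠ a)
    (hN : ∀ w, s(v, w) ∈ E → w = x ∨ w = c ∨ w = a) (h5 : NoFive E v) : False := by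
  have cb : c ≠ b := ha.ne_b hv hc.e1
  have ad : a ≠ d := hc.ne_b hv ha.e1
  have db : d ≠ b := hc.bb ha hca
  have vx : v ≠ x := by rintro rfl; exact C.nd _ ex
  have vc := tne hv hc.ta
  have vd := tne hv hc.tb
  have va := tne hv ha.ta
  have vb := tne hv ha.tb
  have xc := tne hx hc.ta
  have xd := tne hx hc.tb
  have xa := tne hx ha.ta
  have xb := tne hx ha.tb
  have yc := tne hc.tu hc.ta
  have yd := tne hc.tu hc.tb
  have ya := tne hc.tu ha.ta
  have yb := tne hc.tu ha.tb
  have zc := tne ha.tu hc.ta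
  have zd := tne ha.tu hc.tb
  have za := tne ha.tu ha.ta
  have zb := tne ha.tu ha.tb
  have vy := hc.vu
  have vz := ha.vu
  have ab := ha.ab
  have cd := hc.ab
  have hext : ∀ f, ClrOff f E {v, c, d, a, b} → OkB (f x) (f y) (f z) → False := by
    rintro f hf ⟨t, t1, t2, t3⟩
    have g1 := step C.nd t hf (by
      intro u hu huI
      rcases hN u hu with rfl | rfl | rfl
      · exact t1
      · simp at huI
      · simp at huI)
    obtain ⟨f2, g2, k2⟩ := str2 C.nd hc.Na hc.Nb yc g1 (by
      rw [Function.update_self, Function.update_of_ne vy.symm]; exact t2)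
    obtain ⟨f3, g3, -⟩ := str2 (I := ∅) C.nd ha.Na ha.Nb za g2 (by
      rw [k2 v vc vd, k2 z zc zd, Function.update_self, Function.update_of_ne vz.symm]; exact t3)
    exact C.ncol (col_of_off g3)
  have xy : x ≠ y := by
    rintro rfl
    obtain ⟨f, hf⟩ := colOff C {v, c, d, a, b} v (by simp)
    exact hext f hf (okB_of _ _ _ (by generalize f x = q; revert q; decide))
  refine redB C OkB okB_of finB1 finB2 {v, c, d, a, b} x y z v c d a b ?_ ?_ ?_ xy ?_ ?_ ?_ ?_ ?_
    vc vd cd va vb hca cb ad.symm db ab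
    (by rw [Sym2.eq_swap]; exact ex) hc.e1 hc.e2 hc.e3 ?_ hext ?_
  · simp [vx.symm, xc, xd, xa, xb]
  · simp [vy.symm, yc, yd, ya, yb]
  · simp [vz.symm, zc, zd, za, zb]
  · simp
  · simp
  · simp
  · simp
  · simp
  · refine cardOff _ [s(v, x), s(v, c), s(c, d), s(d, y), s(v, a), s(a, b), s(b, z)] ?_ ?_ ?_
    · simp only [List.nodup_cons, List.mem_cons, Sym2.eq_iff, List.not_mem_nil, List.nodup_nil]
      grind
    · simp [ex, hc.e1, hc.e2, hc.e3, ha.e1, ha.e2, ha.e3]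
    · simp
  · intro hxyE
    refine h5 x y d c ex hxyE (by rw [Sym2.eq_swap]; exact hc.e3)
      (by rw [Sym2.eq_swap]; exact hc.e2) (by rw [Sym2.eq_swap]; exact hc.e1) ?_
    simp only [List.nodup_cons, List.mem_cons, List.not_mem_nil, List.nodup_nil]
    grind

lemma caseC {E : Finset (Sym2 V)} (C : Ctx E) (T : V → Prop) {v m x n y a b z : V} (hv : T v)
    (hm : S1 E T v m x) (hn : S1 E T v n y) (ha : S2 E T v a b z) (hmn : m ≠ n) (hma : m ≠ a)
    (hna : n ≠ a)
    (hN : ∀ w, s(v, w) ∈ E → w = m ∨ w = n ∨ w = a) (h5 : NoFive E v) : False := by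
  have mb : m ≠ b := ha.ne_b hv hm.e1
  have nb : n ≠ b := ha.ne_b hv hn.e1
  have vm := tne hv hm.tm
  have vn := tne hv hn.tm
  have va := tne hv ha.ta
  have vb := tne hv ha.tb
  have xm := tne hm.tu hm.tm
  have xn := tne hm.tu hn.tm
  have xa := tne hm.tu ha.ta
  have xb := tne hm.tu ha.tb
  have ym := tne hn.tu hm.tm
  have yn := tne hn.tu hn.tm
  have ya := tne hn.tu ha.ta
  have yb := tne hn.tu ha.tb
  have zm := tne ha.tu hm.tm
  have zn := tne ha.tu hn.tm
  have za := tne ha.tu ha.ta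
  have zb := tne ha.tu ha.tb
  have vx := hm.vu
  have vy := hn.vu
  have vz := ha.vu
  have ab := ha.ab
  have hext : ∀ f, ClrOff f E {v, m, n, a, b} → OkC (f x) (f y) (f z) → False := by
    rintro f hf ⟨t, t1, t2, t3⟩
    have g1 := step C.nd t hf (by
      intro u hu huI
      rcases hN u hu with rfl | rfl | rfl <;> simp at huI)
    obtain ⟨f1, g1, k1⟩ := str1 C.nd hm.N g1 (by
      rw [Function.update_self, Function.update_of_ne vx.symm]; exact t1)
    obtain ⟨f2, g2, k2⟩ := str1 C.nd hn.N g1 (by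
      rw [k1 v vm, k1 y ym, Function.update_self, Function.update_of_ne vy.symm]; exact t2)
    obtain ⟨f3, g3, -⟩ := str2 (I := ∅) C.nd ha.Na ha.Nb za g2 (by
      rw [k2 v vn, k2 z zn, k1 v vm, k1 z zm, Function.update_self,
        Function.update_of_ne vz.symm]; exact t3)
    exact C.ncol (col_of_off g3)
  have xy : x ≠ y := by
    rintro rfl
    obtain ⟨f, hf⟩ := colOff C {v, m, n, a, b} v (by simp)
    exact hext f hf (okC_of _ _ _ (by generalize f x = q; revert q; decide))
  refine redB C OkC okC_of finC1 finC2 {v, m, n, a, b} x y z m v n a b ?_ ?_ ?_ xy ?_ ?_ ?_ ?_ ?_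
    vm.symm hmn vn hma mb va vb hna nb ab
    (by rw [Sym2.eq_swap]; exact hm.e2) (by rw [Sym2.eq_swap]; exact hm.e1) hn.e1 hn.e2 ?_ hext ?_
  · simp [vx.symm, xm, xn, xa, xb]
  · simp [vy.symm, ym, yn, ya, yb]
  · simp [vz.symm, zm, zn, za, zb]
  · simp
  · simp
  · simp
  · simp
  · simp
  · refine cardOff _ [s(v, m), s(m, x), s(v, n), s(n, y), s(v, a), s(a, b), s(b, z)] ?_ ?_ ?_
    · simp only [List.nodup_cons, List.mem_cons, Sym2.eq_iff, List.not_mem_nil, List.nodup_nil]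
      grind
    · simp [hm.e1, hm.e2, hn.e1, hn.e2, ha.e1, ha.e2, ha.e3]
    · simp
  · intro hxyE
    refine h5 m x y n hm.e1 hm.e2 hxyE (by rw [Sym2.eq_swap]; exact hn.e2)
      (by rw [Sym2.eq_swap]; exact hn.e1) ?_
    simp only [List.nodup_cons, List.mem_cons, List.not_mem_nil, List.nodup_nil]
    grind

lemma exD : ∀ a b c : Fin 5, ∃ t, two t a ∧ t ≠ b ∧ t ≠ c := by decide

lemma exE : ∀ a b : Fin 5, ∃ t, A5 t a ∧ t ≠ b := by decide

lemma caseD {E : Finset (Sym2 V)} (C : Ctx E) (T : V → Prop) {v m x c d y a b z : V} (hv : T v)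
    (tm : ¬ T m) (vx : v ≠ x) (Nm : ∀ w, s(m, w) ∈ E → w = v ∨ w = x)
    (hc : S2 E T v c d y) (ha : S2 E T v a b z)
    (hN : ∀ w, s(v, w) ∈ E → w = m ∨ w = c ∨ w = a) : False := by
  have vm := tne hv tm
  have vc := tne hv hc.ta
  have vd := tne hv hc.tb
  have ym := tne hc.tu tm
  have yc := tne hc.tu hc.ta
  have zm := tne ha.tu tm
  have zc := tne ha.tu hc.ta
  have zd := tne ha.tu hc.tb
  have za := tne ha.tu ha.ta
  obtain ⟨f, hf⟩ := colOff C {v, m, c, d, a, b} v (by simp)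
  obtain ⟨t, t1, t2, t3⟩ := exD (f x) (f y) (f z)
  have g1 := step C.nd t hf (by
    intro u hu huI
    rcases hN u hu with rfl | rfl | rfl <;> simp at huI)
  obtain ⟨f1, g1, k1⟩ := str1 C.nd Nm g1 (by
    rw [Function.update_self, Function.update_of_ne vx.symm]; exact t1)
  obtain ⟨f2, g2, k2⟩ := str2 C.nd hc.Na hc.Nb yc g1 (by
    rw [k1 v vm, k1 y ym, Function.update_self, Function.update_of_ne hc.vu.symm]; exact t2)
  obtain ⟨f3, g3, -⟩ := str2 (I := ∅) C.nd ha.Na ha.Nb za g2 (by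
    rw [k2 v vc vd, k2 z zc zd, k1 v vm, k1 z zm, Function.update_self,
      Function.update_of_ne ha.vu.symm]; exact t3)
  exact C.ncol (col_of_off g3)

lemma caseE {E : Finset (Sym2 V)} (C : Ctx E) {v a b c d : V}
    (Na : ∀ w, s(a, w) ∈ E → w = v ∨ w = b) (Nb : ∀ w, s(b, w) ∈ E → w = a ∨ w = c)
    (Nc : ∀ w, s(c, w) ∈ E → w = b ∨ w = d) (da : d ≠ a) (db : d ≠ b) : False := by
  obtain ⟨f, hf⟩ := colOff C {a, b, c} a (by simp)
  obtain ⟨t, t1, t2⟩ := exE (f v) (f d)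
  have g1 := step C.nd t hf (by
    intro u hu huI
    rcases Na u hu with rfl | rfl
    · exact t1
    · simp at huI)
  obtain ⟨f3, g3, -⟩ := str2 (I := ∅) C.nd Nb Nc db g1 (by
    rw [Function.update_self, Function.update_of_ne da]; exact t2)
  exact C.ncol (col_of_off g3)

/-! ## From a smallest counterexample to its edge set -/

lemma adj5 : ∀ a b : Fin 5, (cycleGraph 5).Adj a b ↔ A5 a b := by
  intro a b
  rw [cycleGraph_adj]; rfl

lemma col_of_hom {W : Type} {G : SimpleGraph W} {E : Finset (Sym2 W)}
    (hE : ∀ a b, s(a, b) ∈ E ↔ G.Adj a b) (f : G →g cycleGraph 5) : Col E :=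
  ⟨f, fun a b hab => (adj5 _ _).1 (f.map_rel ((hE a b).1 hab))⟩

lemma hom_of_col {W : Type} {G : SimpleGraph W} {E : Finset (Sym2 W)}
    (hE : ∀ a b, s(a, b) ∈ E ↔ G.Adj a b) (h : Col E) : Nonempty (G →g cycleGraph 5) := by
  obtain ⟨f, hf⟩ := h
  exact ⟨⟨f, fun {a b} hab => (adj5 _ _).2 (hf a b ((hE a b).2 hab))⟩⟩

/-- The spanning subgraph with a given set of edges. -/
def subOf {W : Type} {G : SimpleGraph W} (E' : Finset (Sym2 W))
    (hE : ∀ a b, s(a, b) ∈ E' → G.Adj a b) : G.Subgraph where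
  verts := Set.univ
  Adj a b := s(a, b) ∈ E'
  adj_sub := fun {a b} h => hE a b h
  edge_vert := fun _ => Set.mem_univ _
  symm := ⟨fun a b h => by rw [Sym2.eq_swap]; exact h⟩

lemma crit_edges {W : Type} {G : SimpleGraph W} (hG : Critical52 G) {E : Finset (Sym2 W)}
    (hE : ∀ a b, s(a, b) ∈ E ↔ G.Adj a b) (E' : Finset (Sym2 W)) (h : E' ⊂ E) : Col E' := by
  have hsub : ∀ a b, s(a, b) ∈ E' → G.Adj a b := fun a b hab => (hE a b).1 (h.1 hab)
  obtain ⟨f⟩ := hG.2 (subOf E' hsub) (by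
    intro htop
    apply h.2
    intro e he
    induction e using Sym2.ind with
    | _ a b =>
      have h1 : (⊤ : G.Subgraph).Adj a b := (hE a b).1 he
      rw [← htop] at h1
      exact h1)
  refine ⟨fun w => f ⟨w, Set.mem_univ _⟩, fun a b hab => (adj5 _ _).1 (f.map_rel ?_)⟩
  exact hab

lemma crit_cov {W : Type} {G : SimpleGraph W} (hG : Critical52 G) (v : W) :
    ∃ u, G.Adj v u := by
  classical
  by_contra hc
  push Not at hc
  obtain ⟨f⟩ := hG.2 ((⊤ : G.Subgraph).deleteVerts {v}) (by
    intro htop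
    have h1 : v ∈ (⊤ : G.Subgraph).verts := Set.mem_univ _
    rw [← htop] at h1
    simp at h1)
  have hmem : ∀ w, w ≠ v → w ∈ ((⊤ : G.Subgraph).deleteVerts {v}).verts := by
    intro w hw; simp [hw]
  refine hG.1.false ⟨fun w => if hw : w = v then 0 else f ⟨w, hmem w hw⟩, ?_⟩
  intro a b hab
  have ha : a ≠ v := by rintro rfl; exact hc _ hab
  have hb : b ≠ v := by rintro rfl; exact hc _ hab.symm
  simp only [ha, hb, dif_neg, not_false_eq_true]
  apply f.map_rel
  simp [hab, ha, hb]

lemma T3_adj : ∀ a b : Fin 3, (cycleGraph 3).Adj a b ↔ s(a, b) ∈ T3 := by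
  intro a b
  rw [cycleGraph_three_eq_top, top_adj]
  revert a b; decide

lemma Q1_adj : ∀ a b : Fin 10, E1.Adj a b ↔ s(a, b) ∈ Q1 := by
  have key : ∀ a b : Fin 10, s(a, b) ∈ Q1 → a ≠ b := by decide
  intro a b
  rw [E1, fromEdgeSet_adj]
  constructor
  · rintro ⟨h, -⟩; simpa [Q1] using h
  · intro h; exact ⟨by simpa [Q1] using h, key a b h⟩

lemma Q2_adj : ∀ a b : Fin 10, E2.Adj a b ↔ s(a, b) ∈ Q2 := by
  have key : ∀ a b : Fin 10, s(a, b) ∈ Q2 → a ≠ b := by decide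
  intro a b
  rw [E2, fromEdgeSet_adj]
  constructor
  · rintro ⟨h, -⟩; simpa [Q2] using h
  · intro h; exact ⟨by simpa [Q2] using h, key a b h⟩

/-- The graph on `Fin m` spanned by an edge set. -/
def grph {m : ℕ} (K : Finset (Sym2 V)) (hK : ND K) (g : Fin m → V) : SimpleGraph (Fin m) where
  Adj i j := s(g i, g j) ∈ K
  symm := ⟨fun i j h => by rw [Sym2.eq_swap]; exact h⟩
  loopless := ⟨fun i h => hK _ h⟩

lemma grph_critical {m : ℕ} {K : Finset (Sym2 V)} (hK : ND K) (hM : MinU K) (g : Fin m → V)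
    (hg : Function.Injective g) (hs : ∀ v, v ∈ spt K ↔ ∃ i, g i = v) :
    Critical52 (grph K hK g) := by
  classical
  have ext : ∀ F : Finset (Sym2 V), F ⊆ K → ∀ f : Fin m → Fin 5,
      (∀ i j, s(g i, g j) ∈ F → A5 (f i) (f j)) → Col F := by
    intro F hF f hf
    refine ⟨fun v => if hv : ∃ i, g i = v then f hv.choose else 0, fun a b hab => ?_⟩
    obtain ⟨i, rfl⟩ := (hs a).1 (mem_spt.2 ⟨b, hF hab⟩)
    obtain ⟨j, rfl⟩ := (hs b).1 (mem_spt.2 ⟨_, by rw [Sym2.eq_swap]; exact hF hab⟩)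
    have e : ∀ i, (if hv : ∃ i', g i' = g i then f hv.choose else 0) = f i := by
      intro i
      have hv : ∃ i', g i' = g i := ⟨i, rfl⟩
      rw [dif_pos hv, hg hv.choose_spec]
    simp only [e]
    exact hf i j hab
  refine ⟨⟨fun f => hM.1 (ext K (Finset.Subset.refl _) f
    fun i j h => (adj5 _ _).1 (f.map_rel h))⟩, fun H hH => ?_⟩
  -- the edges of the subgraph
  let F : Finset (Sym2 V) := K.filter (fun e => ∃ i j, H.Adj i j ∧ e = s(g i, g j))
  have memF : ∀ i j, s(g i, g j) ∈ F ↔ H.Adj i j := by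
    intro i j
    simp only [F, Finset.mem_filter]
    constructor
    · rintro ⟨-, i', j', h, e⟩
      rw [Sym2.eq_iff] at e
      rcases e with ⟨e1, e2⟩ | ⟨e1, e2⟩
      · rw [hg e1, hg e2]; exact h
      · rw [hg e1, hg e2]; exact h.symm
    · intro h
      exact ⟨H.adj_sub h, i, j, h, rfl⟩
  have hFK : F ≠ K := by
    intro e
    apply hH
    have hadj : ∀ i j, s(g i, g j) ∈ K → H.Adj i j := by
      intro i j h; rw [← e] at h; exact (memF i j).1 h
    refine Subgraph.ext ?_ ?_
    · ext i
      simp only [Subgraph.verts_top, Set.mem_univ, iff_true]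
      obtain ⟨u, hu⟩ := mem_spt.1 ((hs (g i)).2 ⟨i, rfl⟩)
      obtain ⟨j, rfl⟩ := (hs u).1 (mem_spt.2 ⟨g i, by rw [Sym2.eq_swap]; exact hu⟩)
      exact H.edge_vert (hadj i j hu)
    · ext i j
      exact ⟨fun h => H.adj_sub h, fun h => hadj i j h⟩
  obtain ⟨f, hf⟩ := hM.2 F (Finset.ssubset_iff_subset_ne.2 ⟨Finset.filter_subset _ _, hFK⟩)
  refine ⟨⟨fun i => f (g i.1), fun {a b} hab => (adj5 _ _).2 (hf _ _ ((memF _ _).2 ?_))⟩⟩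
  exact hab

lemma grph_edges {m : ℕ} {K : Finset (Sym2 V)} (hK : ND K) (g : Fin m → V)
    (hg : Function.Injective g) (hs : ∀ v, v ∈ spt K ↔ ∃ i, g i = v) :
    (grph K hK g).edgeSet.ncard = K.card := by
  classical
  have h : (Sym2.map g) '' (grph K hK g).edgeSet = (K : Set (Sym2 V)) := by
    ext e
    induction e using Sym2.ind with
    | _ a b =>
      constructor
      · rintro ⟨e', he', h⟩
        induction e' using Sym2.ind with
        | _ i j =>
          rw [← h]
          exact he'
      · intro h
        have h' : s(a, b) ∈ K := h
        obtain ⟨i, rfl⟩ := (hs a).1 (mem_spt.2 ⟨b, h'⟩)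
        obtain ⟨j, rfl⟩ := (hs b).1 (mem_spt.2 ⟨_, by rw [Sym2.eq_swap]; exact h'⟩)
        exact ⟨s(i, j), h', rfl⟩
  rw [← Set.ncard_image_of_injective _ (Sym2.map.injective hg), h, Set.ncard_coe_finset]

lemma copy_of_iso {m k : ℕ} {K : Finset (Sym2 V)} (hK : ND K) (g : Fin m → V)
    (hg : Function.Injective g) (hs : ∀ v, v ∈ spt K ↔ ∃ i, g i = v)
    (B : SimpleGraph (Fin k)) (Q : Finset (Sym2 (Fin k)))
    (hQ : ∀ a b, B.Adj a b ↔ s(a, b) ∈ Q) (i : grph K hK g ≃g B) : Copy Q K := by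
  classical
  refine ⟨fun x => g (i.symm x), fun x y h => i.symm.injective (hg h), ?_⟩
  ext e
  induction e using Sym2.ind with
  | _ a b =>
    rw [Finset.mem_image]
    constructor
    · intro h
      obtain ⟨x, rfl⟩ := (hs a).1 (mem_spt.2 ⟨b, h⟩)
      obtain ⟨y, rfl⟩ := (hs b).1 (mem_spt.2 ⟨_, by rw [Sym2.eq_swap]; exact h⟩)
      refine ⟨s(i x, i y), (hQ _ _).1 (i.map_rel_iff.2 h), ?_⟩
      simp
    · rintro ⟨e', he', h⟩
      induction e' using Sym2.ind with
      | _ x y =>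
        rw [← h]
        have h2 : (grph K hK g).Adj (i.symm x) (i.symm y) := i.symm.map_rel_iff.2 ((hQ x y).2 he')
        exact h2

lemma ctx_of {G : SimpleGraph V} (h : SmallestCex G) {E : Finset (Sym2 V)}
    (hE : ∀ a b, s(a, b) ∈ E ↔ G.Adj a b) : Ctx E := by
  classical
  obtain ⟨hc, h3, h1, h2, hp, hmin⟩ := h
  have ncol : ¬ Col E := fun h => by
    obtain ⟨f⟩ := hom_of_col hE h
    exact hc.1.false f
  have cov : ∀ v, ∃ u, s(v, u) ∈ E := fun v => by
    obtain ⟨u, hu⟩ := crit_cov hc v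
    exact ⟨u, (hE _ _).2 hu⟩
  have hcard : G.edgeSet.ncard = E.card := by
    rw [← Set.ncard_coe_finset]
    congr 1
    ext e
    induction e using Sym2.ind with
    | _ a b => exact (hE a b).symm
  refine ⟨fun a ha => G.loopless.irrefl a ((hE a a).1 ha), ncol, crit_edges hc hE, cov, ?_, ?_, ?_⟩
  · unfold pot at hp
    rw [hcard] at hp
    omega
  · intro a b c hab hbc hac
    have nab : a ≠ b := ((hE _ _).1 hab).ne
    have nbc : b ≠ c := ((hE _ _).1 hbc).ne
    have nac : a ≠ c := ((hE _ _).1 hac).ne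
    have hTn : ¬ Col ({s(a, b), s(b, c), s(a, c)} : Finset (Sym2 V)) := by
      rintro ⟨f, hf⟩
      have e1 := hf a b (by simp)
      have e2 := hf b c (by simp)
      have e3 := hf a c (by simp)
      have : ∀ x y z : Fin 5, A5 x y → A5 y z → A5 x z → False := by decide
      exact this _ _ _ e1 e2 e3
    have hTE : ({s(a, b), s(b, c), s(a, c)} : Finset (Sym2 V)) ⊆ E := by
      intro e he
      simp only [Finset.mem_insert, Finset.mem_singleton] at he
      rcases he with rfl | rfl | rfl <;> assumption
    have hT : ({s(a, b), s(b, c), s(a, c)} : Finset (Sym2 V)) = E := by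
      by_contra hne
      exact hTn (crit_edges hc hE _ (Finset.ssubset_iff_subset_ne.2 ⟨hTE, hne⟩))
    have hV : ∀ v, v = a ∨ v = b ∨ v = c := by
      intro v
      obtain ⟨u, hu⟩ := cov v
      rw [← hT] at hu
      simp only [Finset.mem_insert, Finset.mem_singleton, Sym2.eq_iff] at hu
      tauto
    have hinj : Function.Injective ![a, b, c] := by
      intro i j
      fin_cases i <;> fin_cases j <;> simp [nab, nbc, nac, nab.symm, nbc.symm, nac.symm]
    have hbij : Function.Bijective ![a, b, c] := ⟨hinj, fun v => by
      rcases hV v with rfl | rfl | rfl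
      · exact ⟨0, rfl⟩
      · exact ⟨1, rfl⟩
      · exact ⟨2, rfl⟩⟩
    have hadj : ∀ i j : Fin 3, G.Adj (![a, b, c] i) (![a, b, c] j) ↔ (cycleGraph 3).Adj i j := by
      intro i j
      rw [cycleGraph_three_eq_top, top_adj]
      constructor
      · rintro h rfl; exact G.loopless.irrefl _ h
      · have k1 := (hE _ _).1 hab
        have k2 := (hE _ _).1 hbc
        have k3 := (hE _ _).1 hac
        fin_cases i <;> fin_cases j <;> simp [k1, k2, k3, k1.symm, k2.symm, k3.symm]
    have iso : cycleGraph 3 ≃g G :=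
      { toEquiv := Equiv.ofBijective _ hbij
        map_rel_iff' := fun {i j} => hadj i j }
    exact h3.false iso.symm
  · intro K hK hM hlt
    let q := (spt K).equivFin
    let g : Fin (spt K).card → V := fun i => (q.symm i).1
    have hg : Function.Injective g := fun i j h => q.symm.injective (Subtype.ext h)
    have hs : ∀ v, v ∈ spt K ↔ ∃ i, g i = v := by
      intro v
      constructor
      · intro hv
        exact ⟨q ⟨v, hv⟩, by simp [g]⟩
      · rintro ⟨i, rfl⟩
        exact (q.symm i).2
    by_cases n3 : IsEmpty (grph K hK g ≃g cycleGraph 3)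
    · by_cases n1 : IsEmpty (grph K hK g ≃g E1)
      · by_cases n2 : IsEmpty (grph K hK g ≃g E2)
        · left
          have := hmin _ (grph K hK g) (grph_critical hK hM g hg hs) n3 n1 n2 hlt
          unfold pot at this
          rw [grph_edges hK g hg hs, Fintype.card_fin] at this
          omega
        · rw [not_isEmpty_iff] at n2
          obtain ⟨i⟩ := n2
          exact Or.inr (Or.inr (Or.inr (copy_of_iso hK g hg hs _ _ Q2_adj i)))
      · rw [not_isEmpty_iff] at n1
        obtain ⟨i⟩ := n1
        exact Or.inr (Or.inr (Or.inl (copy_of_iso hK g hg hs _ _ Q1_adj i)))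
    · rw [not_isEmpty_iff] at n3
      obtain ⟨i⟩ := n3
      exact Or.inr (Or.inl (copy_of_iso hK g hg hs _ _ T3_adj i))

/-! ## Strings -/

lemma nbr_two {G : SimpleGraph V} {w p q : V} (hd : deg G w = 2) (hp : G.Adj w p)
    (hq : G.Adj w q) (hpq : p ≠ q) : ∀ x, G.Adj w x → x = p ∨ x = q := by
  intro x hx
  have hsub : ({p, q} : Set V) ⊆ G.neighborSet w := by
    rintro y (rfl | rfl) <;> assumption
  have heq := Set.eq_of_subset_of_ncard_le hsub (by
    rw [Set.ncard_pair hpq]; exact le_of_eq hd) (Set.toFinite _)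
  have : x ∈ ({p, q} : Set V) := by rw [heq]; exact hx
  simpa using this

lemma nbr_three {G : SimpleGraph V} {w p q r : V} (hd : deg G w = 3) (hp : G.Adj w p)
    (hq : G.Adj w q) (hr : G.Adj w r) (hpq : p ≠ q) (hpr : p ≠ r) (hqr : q ≠ r) :
    ∀ x, G.Adj w x → x = p ∨ x = q ∨ x = r := by
  intro x hx
  have hsub : ({p, q, r} : Set V) ⊆ G.neighborSet w := by
    rintro y (rfl | rfl | rfl) <;> assumption
  have heq := Set.eq_of_subset_of_ncard_le hsub (by
    rw [Set.ncard_eq_three.2 ⟨p, q, r, hpq, hpr, hqr, rfl⟩]; exact le_of_eq hd) (Set.toFinite _)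
  have : x ∈ ({p, q, r} : Set V) := by rw [heq]; exact hx
  simpa using this

lemma noFive_of {G : SimpleGraph V} {E : Finset (Sym2 V)}
    (hE : ∀ a b, s(a, b) ∈ E ↔ G.Adj a b) {v : V} (h : ¬ InFiveCycle G v) : NoFive E v := by
  intro p q r t h1 h2 h3 h4 h5 hn
  rw [hE] at h1 h2 h3 h4 h5
  apply h
  refine ⟨v, .cons h1 (.cons h2 (.cons h3 (.cons h4 (.cons h5 .nil)))), ?_, rfl, by simp⟩
  rw [Walk.isCycle_def]
  simp only [List.nodup_cons, List.mem_cons, List.not_mem_nil, or_false, not_or,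
    List.nodup_nil, and_true, not_false_eq_true] at hn
  obtain ⟨⟨n1, n2, n3, n4⟩, ⟨n5, n6, n7⟩, ⟨n8, n9⟩, n10⟩ := hn
  refine ⟨?_, by simp, ?_⟩
  · rw [Walk.isTrail_def]
    simp only [Walk.edges_cons, Walk.edges_nil, List.nodup_cons, List.mem_cons,
      List.not_mem_nil, or_false, not_or, Sym2.eq_iff]
    grind
  · simp only [Walk.support_cons, Walk.support_nil, List.tail_cons, List.nodup_cons,
      List.mem_cons, List.not_mem_nil, or_false, not_or]
    grind

/-- The three possible shapes of a string of length `l` leaving `v` through `x`. -/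
def SC (E : Finset (Sym2 V)) (T : V → Prop) (v : V) (l : ℕ) (x : V) : Prop :=
  (l = 1 ∧ T x ∧ s(v, x) ∈ E) ∨ (l = 2 ∧ ∃ y, S1 E T v x y) ∨ (l = 3 ∧ ∃ b y, S2 E T v x b y)

lemma sorted_cases {E : Finset (Sym2 V)} (C : Ctx E) (T : V → Prop) {v : V} (hv : T v)
    (h5 : NoFive E v) {l1 l2 l3 : ℕ} {x1 x2 x3 : V} (c1 : SC E T v l1 x1) (c2 : SC E T v l2 x2)
    (c3 : SC E T v l3 x3) (h12 : x1 ≠ x2) (h13 : x1 ≠ x3) (h23 : x2 ≠ x3)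
    (hN : ∀ w, s(v, w) ∈ E → w = x1 ∨ w = x2 ∨ w = x3) (le12 : l1 ≤ l2) (le23 : l2 ≤ l3) :
    (l1 - 1) + (l2 - 1) + (l3 - 1) ≤ 3 ∧
    ((l1 - 1) + (l2 - 1) + (l3 - 1) = 3 → l1 = 2 ∧ l2 = 2 ∧ l3 = 2) := by
  rcases c3 with ⟨e3, -⟩ | ⟨e3, -⟩ | ⟨e3, b, z, ha⟩
  · omega
  · rcases c1 with ⟨e1, -⟩ | ⟨e1, -⟩ | ⟨e1, -⟩ <;> rcases c2 with ⟨e2, -⟩ | ⟨e2, -⟩ | ⟨e2, -⟩ <;>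
      omega
  rcases c2 with ⟨e2, -⟩ | ⟨e2, y, hm⟩ | ⟨e2, d, y, hc⟩
  · rcases c1 with ⟨e1, -⟩ | ⟨e1, -⟩ | ⟨e1, -⟩ <;> omega
  · rcases c1 with ⟨e1, hx, ex⟩ | ⟨e1, x, hx⟩ | ⟨e1, -⟩
    · exact (caseA C T hv hx ex hm ha h23 hN h5).elim
    · exact (caseC C T hv hx hm ha h12 h13 h23 hN h5).elim
    · omega
  · rcases c1 with ⟨e1, hx, ex⟩ | ⟨e1, x, hx⟩ | ⟨e1, x, x', hx⟩
    · exact (caseB C T hv hx ex hc ha h23 hN h5).elim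
    · exact (caseD C T hv hx.tm hx.vu hx.N hc ha hN).elim
    · exact (caseD C T hv hx.ta (tne hv hx.tb) hx.Na hc ha hN).elim

lemma string_cases {G : SimpleGraph V} {E : Finset (Sym2 V)} (C : Ctx E)
    (hE : ∀ a b, s(a, b) ∈ E ↔ G.Adj a b) {v u : V} (p : G.Walk v u) (hs : IsString G p) :
    SC E (fun w => 3 ≤ deg G w) v p.length (p.getVert 1) := by
  obtain ⟨hp, h0, hv, hu, hd⟩ := hs
  have adj : ∀ i, i < p.length → G.Adj (p.getVert i) (p.getVert (i + 1)) :=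
    fun i hi => p.adj_getVert_succ hi
  have inj : ∀ i j, i ≤ p.length → j ≤ p.length → i ≠ j → p.getVert i ≠ p.getVert j :=
    fun i j hi hj hij h => hij (hp.getVert_injOn hi hj h)
  have z : p.getVert 0 = v := p.getVert_zero
  have hl : p.getVert p.length = u := p.getVert_length
  have d2 : ∀ i, 0 < i → i < p.length → deg G (p.getVert i) = 2 := by
    intro i h1 h2
    apply hd _ (p.getVert_mem_support i)
    · exact fun e => inj i 0 h2.le (Nat.zero_le _) (by omega) (e.trans z.symm)
    · exact fun e => inj i _ h2.le le_rfl (by omega) (e.trans hl.symm)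
  have N : ∀ i, i + 2 ≤ p.length → ∀ x, s(p.getVert (i + 1), x) ∈ E →
      x = p.getVert i ∨ x = p.getVert (i + 2) := by
    intro i hi x hx
    exact nbr_two (d2 (i + 1) (by omega) (by omega)) (adj i (by omega)).symm
      (adj (i + 1) (by omega)) (inj _ _ (by omega) (by omega) (by omega)) x ((hE _ _).1 hx)
  by_cases l1 : p.length = 1
  · left
    refine ⟨l1, ?_, ?_⟩
    · rw [← l1, hl]; exact hu
    · have := (hE _ _).2 (adj 0 h0)
      rwa [z] at this
  by_cases l2 : p.length = 2
  · right; left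
    rw [l2] at hl
    refine ⟨l2, u, ?_, ?_, ?_, hu, ?_, ?_⟩
    · have := (hE _ _).2 (adj 0 h0)
      rwa [z] at this
    · have := (hE _ _).2 (adj 1 (by omega))
      rwa [show 1 + 1 = 2 from rfl, hl] at this
    · have := d2 1 (by omega) (by omega)
      simp only [this]; omega
    · exact fun e => inj 0 2 (by omega) (by omega) (by omega) (z.trans (e.trans hl.symm))
    · have := N 0 (by omega)
      simpa [hl] using this
  by_cases l3 : p.length = 3
  · right; right
    rw [l3] at hl
    refine ⟨l3, p.getVert 2, u, ?_, ?_, ?_, ?_, ?_, hu, ?_, ?_, ?_, ?_⟩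
    · have := (hE _ _).2 (adj 0 h0)
      rwa [z] at this
    · exact (hE _ _).2 (adj 1 (by omega))
    · have := (hE _ _).2 (adj 2 (by omega))
      rwa [show 2 + 1 = 3 from rfl, hl] at this
    · have := d2 1 (by omega) (by omega)
      simp only [this]; omega
    · have := d2 2 (by omega) (by omega)
      simp only [this]; omega
    · exact inj _ _ (by omega) (by omega) (by omega)
    · exact fun e => inj 0 3 (by omega) (by omega) (by omega) (z.trans (e.trans hl.symm))
    · have := N 0 (by omega)
      simpa using this
    · have := N 1 (by omega)
      simpa [hl] using this
  exfalso
  exact caseE C (N 0 (by omega)) (N 1 (by omega)) (N 2 (by omega))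
    (inj _ _ (by omega) (by omega) (by omega)) (inj _ _ (by omega) (by omega) (by omega))

lemma final {G : SimpleGraph V} {E : Finset (Sym2 V)} (C : Ctx E)
    (hE : ∀ a b, s(a, b) ∈ E ↔ G.Adj a b) (v : V) (hdeg : deg G v = 3)
    (hnc : ¬ InFiveCycle G v)
    (u1 u2 u3 : V) (p1 : G.Walk v u1) (p2 : G.Walk v u2) (p3 : G.Walk v u3)
    (hs1 : IsString G p1) (hs2 : IsString G p2) (hs3 : IsString G p3)
    (h12 : p1.getVert 1 ≠ p2.getVert 1) (h13 : p1.getVert 1 ≠ p3.getVert 1)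
    (h23 : p2.getVert 1 ≠ p3.getVert 1) :
    (p1.length - 1) + (p2.length - 1) + (p3.length - 1) ≤ 3 ∧
    ((p1.length - 1) + (p2.length - 1) + (p3.length - 1) = 3 →
      p1.length = 2 ∧ p2.length = 2 ∧ p3.length = 2) := by
  have h5 := noFive_of hE hnc
  have hT : (fun w => 3 ≤ deg G w) v := le_of_eq hdeg.symm
  have ad : ∀ {u : V} (p : G.Walk v u), IsString G p → G.Adj v (p.getVert 1) := by
    intro u p hs
    have := p.adj_getVert_succ hs.2.1
    rwa [p.getVert_zero] at this
  have hN : ∀ w, s(v, w) ∈ E → w = p1.getVert 1 ∨ w = p2.getVert 1 ∨ w = p3.getVert 1 :=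
    fun w hw => nbr_three hdeg (ad p1 hs1) (ad p2 hs2) (ad p3 hs3) h12 h13 h23 w ((hE _ _).1 hw)
  have c1 := string_cases C hE p1 hs1
  have c2 := string_cases C hE p2 hs2
  have c3 := string_cases C hE p3 hs3
  have P := fun {l1 l2 l3 : ℕ} {x1 x2 x3 : V} => @sorted_cases V _ _ E C
    (fun w => 3 ≤ deg G w) v hT h5 l1 l2 l3 x1 x2 x3
  rcases le_total p1.length p2.length with a | a <;>
    rcases le_total p1.length p3.length with b | b <;>
    rcases le_total p2.length p3.length with c | c
  · have := P c1 c2 c3 h12 h13 h23 (fun w hw => by have := hN w hw; tauto) a c; omega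
  · have := P c1 c3 c2 h13 h12 h23.symm (fun w hw => by have := hN w hw; tauto) b c; omega
  · have := P c1 c2 c3 h12 h13 h23 (fun w hw => by have := hN w hw; tauto) a c; omega
  · have := P c3 c1 c2 h13.symm h23.symm h12 (fun w hw => by have := hN w hw; tauto) b a; omega
  · have := P c2 c1 c3 h12.symm h23 h13 (fun w hw => by have := hN w hw; tauto) a b; omega
  · have := P c3 c2 c1 h23.symm h13.symm h12.symm (fun w hw => by have := hN w hw; tauto) c a; omega
  · have := P c2 c3 c1 h23 h12.symm h13.symm (fun w hw => by have := hN w hw; tauto) c b; omega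
  · have := P c3 c2 c1 h23.symm h13.symm h12.symm (fun w hw => by have := hN w hw; tauto) c a; omega

end FH

/-- A vertex of degree 3 of a smallest counterexample that is not
contained in any 5-cycle has weight at most three, and if its weight equals three,
it is a `(1,1,1)`-vertex. (The vertex being a `(k₁,k₂,k₃)`-vertex is expressed by the
three strings `p1`, `p2`, `p3` leaving `v` through its three distinct edges; its weight
is `(p1.length - 1) + (p2.length - 1) + (p3.length - 1)`.) -/
theorem smallestCex_degree_three_weight {V : Type} [Fintype V] (G : SimpleGraph V)
    (h : SmallestCex G) (v : V) (hdeg : deg G v = 3) (hnc : ¬ InFiveCycle G v)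
    (u1 u2 u3 : V) (p1 : G.Walk v u1) (p2 : G.Walk v u2) (p3 : G.Walk v u3)
    (hs1 : IsString G p1) (hs2 : IsString G p2) (hs3 : IsString G p3)
    (h12 : p1.getVert 1 ≠ p2.getVert 1) (h13 : p1.getVert 1 ≠ p3.getVert 1)
    (h23 : p2.getVert 1 ≠ p3.getVert 1) :
    (p1.length - 1) + (p2.length - 1) + (p3.length - 1) ≤ 3 ∧
    ((p1.length - 1) + (p2.length - 1) + (p3.length - 1) = 3 →
      p1.length = 2 ∧ p2.length = 2 ∧ p3.length = 2) := by
  classical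
  have hE : ∀ a b, s(a, b) ∈ G.edgeSet.toFinite.toFinset ↔ G.Adj a b := by
    intro a b
    rw [Set.Finite.mem_toFinset, mem_edgeSet]
  exact FH.final (FH.ctx_of h hE) hE v hdeg hnc u1 u2 u3 p1 p2 p3 hs1 hs2 hs3 h12 h13 h23
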